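/- Let a discrete group π act freely and properly on a simply connected locally compact metric ANR Y, and suppose the covering dimension of Y is at most k. Then the strongly equivariant topological complexity satisfies TC*_π(Y) ≤ k; that is, Y × Y admits an open cover by k+1 sets that are invariant under the (π × π)-action and each of which is π-equivariantly (for the diagonal π-action) deformable to the diagonal Δ(Y). -/

import Mathlib

open Pointwise

universe u

/-- A subset `U ⊆ Z` is `S`-equivariantly deformable to `Δ ⊆ Z` (for a set `S` of
elements of a group `G` acting on `Z`) if there is a homotopy `h_t : U → Z` with `h_0`
the inclusion, `h_1(U) ⊆ Δ`, and each `h_t` equivariant with respect to the elements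
of `S`. -/
def EquivDeformableTo {G Z : Type*} [Group G] [MulAction G Z] [TopologicalSpace Z]
    (S : Set G) (U Δ : Set Z) : Prop :=
  ∃ H : C(unitInterval × ↥U, Z),
    (∀ u : ↥U, H (0, u) = (u : Z)) ∧ (∀ u : ↥U, H (1, u) ∈ Δ) ∧
    ∀ (t : unitInterval) (g : G), g ∈ S → ∀ u u' : ↥U,
      (u' : Z) = g • (u : Z) → H (t, u') = g • H (t, u)

/-- A space `Y` is an ANR (absolute neighborhood retract) if whenever it is embedded as a
closed subset of a metrizable space, it is a retract of some open neighborhood of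
itself. -/
def IsANR (Y : Type u) [TopologicalSpace Y] : Prop :=
  ∀ (Z : Type u) [TopologicalSpace Z], TopologicalSpace.MetrizableSpace Z →
    ∀ e : Y → Z, Topology.IsClosedEmbedding e →
      ∃ (W : Set Z) (r : C(↥W, Z)), IsOpen W ∧ Set.range e ⊆ W ∧
        (∀ w : ↥W, r w ∈ Set.range e) ∧ ∀ (y : Y) (h : e y ∈ W), r ⟨e y, h⟩ = e y

/-- The covering dimension of `Y` is at most `n`: every open cover of `Y` admits an open
refinement in which every point lies in at most `n + 1` members. -/
def CovDimLE (Y : Type*) [TopologicalSpace Y] (n : ℕ) : Prop :=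
  ∀ 𝒰 : Set (Set Y), (∀ U ∈ 𝒰, IsOpen U) → ⋃₀ 𝒰 = Set.univ →
    ∃ 𝒱 : Set (Set Y), (∀ V ∈ 𝒱, IsOpen V) ∧ ⋃₀ 𝒱 = Set.univ ∧
      (∀ V ∈ 𝒱, ∃ U ∈ 𝒰, V ⊆ U) ∧
      ∀ y : Y, {V ∈ 𝒱 | y ∈ V}.Finite ∧ {V ∈ 𝒱 | y ∈ V}.ncard ≤ n + 1

section AuxMain

open Set Topology

theorem aux_sigmaCompact (Y : Type*) [TopologicalSpace Y] [T2Space Y] [ParacompactSpace Y]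
    [LocallyCompactSpace Y] [ConnectedSpace Y] : SigmaCompactSpace Y := by
  choose K hKc hKn using fun y : Y => exists_compact_mem_nhds y
  obtain ⟨v, hvo, hvc, hvf, hvK⟩ := precise_refinement (fun y => interior (K y))
    (fun y => isOpen_interior) (by
      rw [iUnion_eq_univ_iff]; intro y; exact ⟨y, mem_interior_iff_mem_nhds.2 (hKn y)⟩)
  have hfin : ∀ C : Set Y, IsCompact C → {i | (v i ∩ C).Nonempty}.Finite := fun C hC =>
    hvf.finite_nonempty_inter_compact hC
  obtain ⟨y0⟩ := (inferInstance : Nonempty Y)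
  let S : ℕ → Set Y := fun n => Nat.rec {y0} (fun _ C => C ∪ ⋃ i ∈ {i | (v i ∩ C).Nonempty}, K i) n
  have hS : ∀ n, S (n+1) = S n ∪ ⋃ i ∈ {i | (v i ∩ S n).Nonempty}, K i := fun n => rfl
  have hSc : ∀ n, IsCompact (S n) := by
    intro n
    induction n with
    | zero => exact isCompact_singleton
    | succ n ih =>
      rw [hS]
      exact ih.union ((hfin _ ih).isCompact_biUnion fun i _ => hKc i)
  have hvS : ∀ n i, (v i ∩ S n).Nonempty → v i ⊆ S (n+1) := by
    intro n i h x hx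
    rw [hS]
    refine Or.inr (mem_biUnion (show i ∈ {i | (v i ∩ S n).Nonempty} from h) (interior_subset (hvK i hx)))
  have hclopen : IsClopen (⋃ n, S n) := by
    constructor
    · rw [← isOpen_compl_iff, isOpen_iff_mem_nhds]
      intro y hy
      obtain ⟨i, hi⟩ := iUnion_eq_univ_iff.1 hvc y
      refine Filter.mem_of_superset ((hvo i).mem_nhds hi) ?_
      intro z hz hz'
      obtain ⟨n, hn⟩ := mem_iUnion.1 hz'
      exact hy (mem_iUnion.2 ⟨n+1, hvS n i ⟨z, hz, hn⟩ hi⟩)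
    · rw [isOpen_iff_mem_nhds]
      intro y hy
      obtain ⟨n, hn⟩ := mem_iUnion.1 hy
      obtain ⟨i, hi⟩ := iUnion_eq_univ_iff.1 hvc y
      refine Filter.mem_of_superset ((hvo i).mem_nhds hi) ?_
      exact (hvS n i ⟨y, hi, hn⟩).trans (subset_iUnion S (n+1))
  have huniv : (⋃ n, S n) = univ := hclopen.eq_univ ⟨y0, mem_iUnion.2 ⟨0, rfl⟩⟩
  exact ⟨⟨S, hSc, huniv⟩⟩

theorem aux_dim_step {Y X Λ : Type*} [TopologicalSpace Y] [T2Space Y] [TopologicalSpace X] [T2Space X]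
    {k : ℕ} (hdim : CovDimLE Y k) (q : Y → X) (hq : Continuous q) (V : Λ → Set X)
    (hVo : ∀ l, IsOpen (V l)) (hVc : ⋃ l, V l = univ) (K : Set Y) (hK : IsCompact K)
    (hinj : InjOn q K) (F : Set X) (hF : IsClosed F) (hFK : F ⊆ q '' K) :
    ∃ V' : Λ → Set X, (∀ l, IsOpen (V' l)) ∧ ⋃ l, V' l = univ ∧ (∀ l, V' l ⊆ V l) ∧
      (∀ l, V l \ F ⊆ V' l) ∧
      ∀ x ∈ F, ∀ T : Finset Λ, (∀ l ∈ T, x ∈ V' l) → T.card ≤ k + 1 := by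
  classical
  obtain ⟨𝒱, h𝒱o, h𝒱c, h𝒱r, h𝒱n⟩ := hdim (range fun l => q ⁻¹' V l)
    (by rintro _ ⟨l, rfl⟩; exact (hVo l).preimage hq)
    (by
      rw [sUnion_range, iUnion_eq_univ_iff]
      intro y; exact iUnion_eq_univ_iff.1 hVc (q y))
  have h𝒱r' : ∀ v : 𝒱, ∃ l, (v : Set Y) ⊆ q ⁻¹' V l := by
    intro v
    obtain ⟨_, ⟨l, rfl⟩, h⟩ := h𝒱r v v.2
    exact ⟨l, h⟩
  choose τ hτ using h𝒱r'
  let W : Λ → Set Y := fun l => ⋃ v : {v : 𝒱 // τ v = l}, (v.1 : Set Y)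
  have hWo : ∀ l, IsOpen (W l) := fun l => isOpen_iUnion fun v => h𝒱o _ v.1.2
  have hWV : ∀ l, W l ⊆ q ⁻¹' V l := by
    intro l y hy
    obtain ⟨⟨v, rfl⟩, hv⟩ := mem_iUnion.1 hy
    exact hτ v hv
  have hWc : ∀ y, ∃ l, y ∈ W l := by
    intro y
    have : y ∈ ⋃₀ 𝒱 := by rw [h𝒱c]; trivial
    obtain ⟨v, hv, hy⟩ := this
    exact ⟨τ ⟨v, hv⟩, mem_iUnion.2 ⟨⟨⟨v, hv⟩, rfl⟩, hy⟩⟩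
  have hcl : ∀ l, IsClosed (q '' ((K ∩ q ⁻¹' F) \ W l)) := by
    intro l
    refine IsCompact.isClosed (IsCompact.image ?_ hq)
    exact (hK.inter_right (hF.preimage hq)).diff (hWo l)
  refine ⟨fun l => V l \ q '' ((K ∩ q ⁻¹' F) \ W l), fun l => (hVo l).sdiff (hcl l), ?_,
    fun l => sdiff_subset, ?_, ?_⟩
  · rw [iUnion_eq_univ_iff]
    intro x
    by_cases hx : x ∈ F
    · obtain ⟨y, hyK, rfl⟩ := hFK hx
      obtain ⟨l, hl⟩ := hWc y
      refine ⟨l, hWV l hl, ?_⟩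
      rintro ⟨z, ⟨⟨hzK, -⟩, hz⟩, hzy⟩
      rw [hinj hzK hyK hzy] at hz
      exact hz hl
    · obtain ⟨l, hl⟩ := iUnion_eq_univ_iff.1 hVc x
      refine ⟨l, hl, ?_⟩
      rintro ⟨z, ⟨⟨hzK, hzF⟩, hz⟩, rfl⟩
      exact hx hzF
  · rintro l x ⟨hx, hxF⟩
    refine ⟨hx, ?_⟩
    rintro ⟨z, ⟨⟨hzK, hzF⟩, hz⟩, rfl⟩
    exact hxF hzF
  · intro x hx T hT
    obtain ⟨y, hyK, rfl⟩ := hFK hx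
    have hW : ∀ l ∈ T, y ∈ W l := by
      intro l hl
      by_contra hc
      exact (hT l hl).2 ⟨y, ⟨⟨hyK, hx⟩, hc⟩, rfl⟩
    obtain ⟨hfin, hcard⟩ := h𝒱n y
    have : ∀ l : T, ∃ v : 𝒱, τ v = l ∧ y ∈ (v : Set Y) := by
      intro l
      obtain ⟨⟨v, hv⟩, hy⟩ := mem_iUnion.1 (hW l l.2)
      exact ⟨v, hv, hy⟩
    choose w hw hyw using this
    rw [ncard_eq_toFinset_card _ hfin] at hcard
    refine le_trans ?_ hcard
    rw [← Finset.card_attach]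
    refine Finset.card_le_card_of_injOn (fun l => (w l : Set Y)) ?_ ?_
    · intro l _
      simp only [Finite.coe_toFinset, mem_ofPred_eq]
      exact ⟨(w l).2, hyw l⟩
    · intro l _ l' _ h
      have : w l = w l' := Subtype.ext h
      apply Subtype.ext
      rw [← hw l, ← hw l', this]

theorem aux_dim {Y X Λ : Type*} [TopologicalSpace Y] [T2Space Y] [LocallyCompactSpace Y]
    [TopologicalSpace X] [T2Space X] [NormalSpace X] [ParacompactSpace X] [LindelofSpace X] [Nonempty X]
    {k : ℕ} (hdim : CovDimLE Y k) (q : Y → X) (hq : Continuous q) (hqo : IsOpenMap q)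
    (hqs : Function.Surjective q) (hqi : ∀ y, ∃ N ∈ 𝓝 y, InjOn q N) (U : Λ → Set X)
    (hUo : ∀ l, IsOpen (U l)) (hUc : ⋃ l, U l = univ) :
    ∃ V : Λ → Set X, (∀ l, IsOpen (V l)) ∧ ⋃ l, V l = univ ∧ (∀ l, V l ⊆ U l) ∧
      ∀ x, ∀ T : Finset Λ, (∀ l ∈ T, x ∈ V l) → T.card ≤ k + 1 := by
  have hK : ∀ y, ∃ K : Set Y, IsCompact K ∧ K ∈ 𝓝 y ∧ InjOn q K := by
    intro y
    obtain ⟨N, hN, hi⟩ := hqi y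
    obtain ⟨K, hKn, hKN, hKc⟩ := local_compact_nhds hN
    exact ⟨K, hKc, hKn, hi.mono hKN⟩
  choose K hKc hKn hKi using hK
  -- countable subcover
  obtain ⟨r, hr, hrc⟩ : ∃ r : Set Y, r.Countable ∧ ⋃ y ∈ r, q '' interior (K y) = univ := by
    obtain ⟨r, hr, hrc⟩ := isLindelof_univ.elim_countable_subcover (fun y => q '' interior (K y))
      (fun y => hqo _ isOpen_interior) (by
        intro x _
        obtain ⟨y, rfl⟩ := hqs x
        exact mem_iUnion.2 ⟨y, y, mem_interior_iff_mem_nhds.2 (hKn y), rfl⟩)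
    exact ⟨r, hr, univ_subset_iff.1 hrc⟩
  have hrne : r.Nonempty := by
    obtain ⟨x⟩ := (inferInstance : Nonempty X)
    have : x ∈ ⋃ y ∈ r, q '' interior (K y) := by rw [hrc]; trivial
    simp only [mem_iUnion] at this
    obtain ⟨y, hy, -⟩ := this
    exact ⟨y, hy⟩
  obtain ⟨f, rfl⟩ := hr.exists_eq_range hrne
  obtain ⟨O, hOo, hOc, hOf, hOK⟩ := precise_refinement (fun n => q '' interior (K (f n)))
    (fun y => hqo _ isOpen_interior) (by simpa using hrc)
  obtain ⟨F, hFc, hFcl, hFO⟩ := exists_iUnion_eq_closed_subset hOo hOf.point_finite hOc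
  have hFf : LocallyFinite F := hOf.subset hFO
  have hFK : ∀ n, F n ⊆ q '' K (f n) := fun n =>
    (hFO n).trans ((hOK n).trans (image_mono interior_subset))
  -- the inductive sequence
  let 𝒟 := {V : Λ → Set X // (∀ l, IsOpen (V l)) ∧ ⋃ l, V l = univ}
  have step : ∀ (n : ℕ) (V : 𝒟), ∃ V' : 𝒟, (∀ l, V'.1 l ⊆ V.1 l) ∧ (∀ l, V.1 l \ F n ⊆ V'.1 l) ∧
      ∀ x ∈ F n, ∀ T : Finset Λ, (∀ l ∈ T, x ∈ V'.1 l) → T.card ≤ k + 1 := by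
    intro n V
    obtain ⟨V', h1, h2, h3, h4, h5⟩ := aux_dim_step hdim q hq V.1 V.2.1 V.2.2 (K (f n)) (hKc _) (hKi _)
      (F n) (hFcl n) (hFK n)
    exact ⟨⟨V', h1, h2⟩, h3, h4, h5⟩
  choose nx hnx1 hnx2 hnx3 using step
  let V : ℕ → 𝒟 := fun n => Nat.rec ⟨U, hUo, hUc⟩ (fun n W => nx n W) n
  have hV : ∀ n, V (n+1) = nx n (V n) := fun n => rfl
  have hanti : ∀ l, Antitone fun n => (V n).1 l := by
    intro l
    refine antitone_nat_of_succ_le fun n => ?_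
    rw [hV]; exact hnx1 n _ l
  have hloc : ∀ x, ∃ O ∈ 𝓝 x, ∃ N, ∀ n ≥ N, ∀ l, (V N).1 l ∩ O ⊆ (V n).1 l := by
    intro x
    obtain ⟨O, hO, hfin⟩ := hFf x
    obtain ⟨N, hN⟩ := hfin.bddAbove
    refine ⟨O, hO, N+1, ?_⟩
    intro n hn l
    induction n, hn using Nat.le_induction with
    | base => exact inter_subset_left
    | succ n hn ih =>
      intro z hz
      rw [hV]
      refine hnx2 n _ l ⟨ih hz, fun hzF => ?_⟩
      have : n ≤ N := hN ⟨z, hzF, hz.2⟩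
      omega
  have hloc' : ∀ x, ∃ O ∈ 𝓝 x, ∃ N, ∀ l, (V N).1 l ∩ O ⊆ ⋂ n, (V n).1 l := by
    intro x
    obtain ⟨O, hO, N, h⟩ := hloc x
    refine ⟨O, hO, N, fun l z hz => mem_iInter.2 fun n => ?_⟩
    rcases le_total N n with hn | hn
    · exact h n hn l hz
    · exact hanti l hn hz.1
  refine ⟨fun l => ⋂ n, (V n).1 l, ?_, ?_, ?_, ?_⟩
  · intro l
    rw [isOpen_iff_mem_nhds]
    intro x hx
    obtain ⟨O, hO, N, h⟩ := hloc' x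
    exact Filter.mem_of_superset (Filter.inter_mem (((V N).2.1 l).mem_nhds (mem_iInter.1 hx N)) hO) (h l)
  · rw [iUnion_eq_univ_iff]
    intro x
    obtain ⟨O, hO, N, h⟩ := hloc' x
    obtain ⟨l, hl⟩ := iUnion_eq_univ_iff.1 (V N).2.2 x
    exact ⟨l, h l ⟨hl, mem_of_mem_nhds hO⟩⟩
  · intro l x hx
    exact mem_iInter.1 hx 0
  · intro x T hT
    obtain ⟨n, hn⟩ := iUnion_eq_univ_iff.1 hFc x
    refine hnx3 n (V n) x hn T fun l hl => ?_
    exact mem_iInter.1 (hT l hl) (n+1)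
/-- Coloured families: `k + n` colours, every point lying in at least `n` of them. -/
def AuxKolm {X Λ : Type*} [TopologicalSpace X] (V : Λ → Set X) (k n : ℕ) (𝒞 : ℕ → Set (Set X)) : Prop :=
  (∀ j, ∀ P ∈ 𝒞 j, IsOpen P) ∧ (∀ j, ∀ P ∈ 𝒞 j, ∃ l, P ⊆ V l) ∧
  (∀ j, ∀ P ∈ 𝒞 j, ∀ P' ∈ 𝒞 j, (P ∩ P').Nonempty → P = P') ∧
  ∀ x, ∃ J : Finset ℕ, J ⊆ Finset.range (k + n) ∧ J.card = n ∧ ∀ j ∈ J, x ∈ ⋃₀ 𝒞 j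

theorem aux_kolm_base {X Λ : Type*} [TopologicalSpace X] [NormalSpace X] [ParacompactSpace X]
    (V : Λ → Set X) (hVo : ∀ l, IsOpen (V l)) (hVc : ⋃ l, V l = univ) (k : ℕ)
    (hord : ∀ x, ∀ T : Finset Λ, (∀ l ∈ T, x ∈ V l) → T.card ≤ k + 1) :
    ∃ 𝒞, AuxKolm V k 1 𝒞 := by
  classical
  obtain ⟨f, hf⟩ := PartitionOfUnity.exists_isSubordinate isClosed_univ V hVo hVc.ge
  have hfV : ∀ l x, f l x ≠ 0 → x ∈ V l := fun l x h => hf l (subset_tsupport _ h)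
  let P : Finset Λ → Set X := fun S => {x | ∀ a ∈ S, 0 < f a x ∧ ∀ b ∉ S, f b x < f a x}
  have hPo : ∀ S, IsOpen (P S) := by
    intro S
    rw [isOpen_iff_mem_nhds]
    intro x hx
    obtain ⟨O, hO, hfin⟩ := f.locallyFinite x
    have h1 : ∀ᶠ z in 𝓝 x, ∀ a ∈ S, 0 < f a z := by
      rw [Filter.eventually_all_finset]
      intro a ha
      exact (f a).continuous.continuousAt.eventually (lt_mem_nhds (hx a ha).1)
    have h2 : ∀ᶠ z in 𝓝 x, ∀ a ∈ S, ∀ b ∈ hfin.toFinset, b ∉ S → f b z < f a z := by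
      rw [Filter.eventually_all_finset]
      intro a ha
      rw [Filter.eventually_all_finset]
      intro b _
      by_cases hb : b ∈ S
      · exact Filter.Eventually.of_forall fun z h => absurd hb h
      · filter_upwards [(f b).continuous.continuousAt.eventually_lt (f a).continuous.continuousAt
          ((hx a ha).2 b hb)] with z hz _ using hz
    filter_upwards [hO, h1, h2] with z hzO h1 h2 a ha
    refine ⟨h1 a ha, fun b hb => ?_⟩
    by_cases hbT : b ∈ hfin.toFinset
    · exact h2 a ha b hbT hb
    · have : f b z = 0 := by
        by_contra h
        exact hbT (hfin.mem_toFinset.2 ⟨z, h, hzO⟩)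
      rw [this]; exact h1 a ha
  refine ⟨fun j => {Q | ∃ S : Finset Λ, S.card = j + 1 ∧ Q = P S}, ?_, ?_, ?_, ?_⟩
  · rintro j _ ⟨S, -, rfl⟩; exact hPo S
  · rintro j _ ⟨S, hS, rfl⟩
    obtain ⟨a, ha⟩ := Finset.card_pos.1 (by omega : 0 < S.card)
    exact ⟨a, fun x hx => hfV a x (hx a ha).1.ne'⟩
  · rintro j _ ⟨S, hS, rfl⟩ _ ⟨S', hS', rfl⟩ ⟨x, hx, hx'⟩
    by_contra hne
    have hne' : S ≠ S' := fun h => hne (by rw [h])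
    have h1 : ∃ a ∈ S, a ∉ S' := by
      by_contra h; push Not at h
      exact hne' (Finset.eq_of_subset_of_card_le h (by omega))
    have h2 : ∃ a ∈ S', a ∉ S := by
      by_contra h; push Not at h
      exact hne' (Finset.eq_of_subset_of_card_le h (by omega)).symm
    obtain ⟨a, ha, ha'⟩ := h1
    obtain ⟨b, hb, hb'⟩ := h2
    exact lt_asymm ((hx a ha).2 b hb') ((hx' b hb).2 a ha')
  · intro x
    obtain ⟨i, hi⟩ := f.exists_pos (mem_univ x)
    have hfin : {l | f l x ≠ 0}.Finite := f.locallyFinite.point_finite x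
    obtain ⟨m, hm, hmax⟩ := hfin.toFinset.exists_max_image (fun l => f l x)
      ⟨i, hfin.mem_toFinset.2 hi.ne'⟩
    have hmpos : 0 < f m x := lt_of_lt_of_le hi (hmax i (hfin.mem_toFinset.2 hi.ne'))
    let S := hfin.toFinset.filter fun l => f l x = f m x
    have hSpos : 0 < S.card := Finset.card_pos.2 ⟨m, Finset.mem_filter.2 ⟨hm, rfl⟩⟩
    have hSle : S.card ≤ k + 1 := hord x S fun l hl =>
      hfV l x (hfin.mem_toFinset.1 (Finset.mem_filter.1 hl).1)
    refine ⟨{S.card - 1}, ?_, by simp, ?_⟩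
    · intro j hj; rw [Finset.mem_singleton] at hj; rw [Finset.mem_range]; omega
    · intro j hj
      rw [Finset.mem_singleton] at hj
      refine ⟨P S, ⟨S, by omega, rfl⟩, ?_⟩
      intro a ha
      have ha' := (Finset.mem_filter.1 ha).2
      rw [ha']
      refine ⟨hmpos, fun b hb => ?_⟩
      by_cases hb0 : f b x = 0
      · rw [hb0]; exact hmpos
      · have hb1 := hfin.mem_toFinset.2 hb0
        refine lt_of_le_of_ne (hmax b hb1) fun h => hb (Finset.mem_filter.2 ⟨hb1, h⟩)

theorem aux_kolm_step {X Λ : Type*} [TopologicalSpace X] [NormalSpace X]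
    (V : Λ → Set X) (k n : ℕ) (hn : 1 ≤ n) (𝒞) (h𝒞 : AuxKolm V k n 𝒞) :
    ∃ 𝒞', AuxKolm V k (n + 1) 𝒞' := by
  classical
  obtain ⟨hO, hr, hd, hc⟩ := h𝒞
  let σ := {S : Finset ℕ // S ∈ (Finset.range (k + n)).powersetCard n}
  let C : ℕ → Set X := fun j => ⋃₀ 𝒞 j
  have hCo : ∀ j, IsOpen (C j) := fun j => isOpen_sUnion (hO j)
  let CS : σ → Set X := fun S => ⋂ j ∈ S.1, C j
  have hCSo : ∀ S, IsOpen (CS S) := fun S => isOpen_biInter_finset fun j _ => hCo j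
  have hCSc : ⋃ S, CS S = univ := by
    rw [iUnion_eq_univ_iff]
    intro x
    obtain ⟨J, h1, h2, h3⟩ := hc x
    exact ⟨⟨J, Finset.mem_powersetCard.2 ⟨h1, h2⟩⟩, mem_iInter₂.2 h3⟩
  obtain ⟨E, hEc, hEcl, hES⟩ := exists_iUnion_eq_closed_subset hCSo (fun x => toFinite _) hCSc
  let H : ℕ → Set X := fun j => ⋃ S : {S : σ // j ∈ S.1}, E S.1
  have hHcl : ∀ j, IsClosed (H j) := fun j => isClosed_iUnion_of_finite fun S => hEcl _
  have hHC : ∀ j, H j ⊆ C j := by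
    intro j x hx
    obtain ⟨⟨S, hS⟩, hx⟩ := mem_iUnion.1 hx
    exact mem_iInter₂.1 (hES S hx) j hS
  let D : σ → Set X := fun S => CS S \ ⋃ j ∈ (Finset.range (k + n)) \ S.1, H j
  have hDo : ∀ S, IsOpen (D S) := fun S =>
    (hCSo S).sdiff ((Finset.finite_toSet _).isClosed_biUnion fun j _ => hHcl j)
  have hSne : ∀ S : σ, ∃ j, j ∈ S.1 := by
    intro S
    have := (Finset.mem_powersetCard.1 S.2).2
    exact Finset.card_pos.1 (by omega)
  choose js hjs using hSne
  have hDD : ∀ S S' x, x ∈ D S → x ∈ D S' → S = S' := by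
    intro S S' x hx hx'
    obtain ⟨T, hT⟩ := iUnion_eq_univ_iff.1 hEc x
    have key : ∀ S : σ, x ∈ D S → T = S := by
      intro S hx
      have hTS : T.1 ⊆ S.1 := by
        intro j hj
        by_contra hjS
        refine hx.2 (mem_biUnion (x := j) ?_ (mem_iUnion.2 ⟨⟨T, hj⟩, hT⟩))
        exact Finset.mem_coe.2 (Finset.mem_sdiff.2 ⟨(Finset.mem_powersetCard.1 T.2).1 hj, hjS⟩)
      apply Subtype.ext
      refine Finset.eq_of_subset_of_card_le hTS ?_
      rw [(Finset.mem_powersetCard.1 T.2).2, (Finset.mem_powersetCard.1 S.2).2]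
    rw [← key S hx, ← key S' hx']
  let N : Set (Set X) := {Q | ∃ S : σ, ∃ P ∈ 𝒞 (js S), Q = D S ∩ P}
  have hup : ∀ j (Q : Set X), Q ∈ Function.update 𝒞 (k + n) N j → (Q ∈ N ∧ j = k + n) ∨ Q ∈ 𝒞 j := by
    intro j Q hQ
    by_cases hj : j = k + n
    · subst hj; rw [Function.update_self] at hQ; exact Or.inl ⟨hQ, rfl⟩
    · rw [Function.update_of_ne hj] at hQ; exact Or.inr hQ
  refine ⟨Function.update 𝒞 (k + n) N, ?_, ?_, ?_, ?_⟩
  · intro j Q hQ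
    rcases hup j Q hQ with ⟨⟨S, P, hP, rfl⟩, -⟩ | h
    · exact (hDo S).inter (hO _ P hP)
    · exact hO j Q h
  · intro j Q hQ
    rcases hup j Q hQ with ⟨⟨S, P, hP, rfl⟩, -⟩ | h
    · obtain ⟨l, hl⟩ := hr _ P hP
      exact ⟨l, inter_subset_right.trans hl⟩
    · exact hr j Q h
  · intro j Q hQ Q' hQ'
    by_cases hj : j = k + n
    · subst hj
      rw [Function.update_self] at hQ hQ'
      obtain ⟨S, P, hP, rfl⟩ := hQ
      obtain ⟨S', P', hP', rfl⟩ := hQ'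
      rintro ⟨x, ⟨hxS, hxP⟩, ⟨hxS', hxP'⟩⟩
      have := hDD S S' x hxS hxS'
      subst this
      rw [hd _ P hP P' hP' ⟨x, hxP, hxP'⟩]
    · rw [Function.update_of_ne hj] at hQ hQ'
      exact hd j Q hQ Q' hQ'
  · intro x
    have hcov : ∀ j < k + n, x ∈ C j → x ∈ ⋃₀ Function.update 𝒞 (k + n) N j := by
      intro j hj hx
      rw [Function.update_of_ne hj.ne]; exact hx
    let J := (Finset.range (k + n)).filter fun j => x ∈ C j
    have hJn : n ≤ J.card := by
      obtain ⟨J', h1, h2, h3⟩ := hc x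
      rw [← h2]
      exact Finset.card_le_card fun j hj => Finset.mem_filter.2 ⟨h1 hj, h3 j hj⟩
    rcases hJn.eq_or_lt with h | h
    · let S : σ := ⟨J, Finset.mem_powersetCard.2 ⟨Finset.filter_subset _ _, h.symm⟩⟩
      have hxS : x ∈ D S := by
        refine ⟨mem_iInter₂.2 fun j hj => (Finset.mem_filter.1 hj).2, ?_⟩
        intro hx
        obtain ⟨j, hj, hxj⟩ := mem_iUnion₂.1 hx
        obtain ⟨hj1, hj2⟩ := Finset.mem_sdiff.1 hj
        exact hj2 (Finset.mem_filter.2 ⟨hj1, hHC j hxj⟩)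
      obtain ⟨P, hP, hxP⟩ := (Finset.mem_filter.1 (hjs S)).2
      refine ⟨insert (k + n) J, ?_, ?_, ?_⟩
      · intro j hj
        rw [Finset.mem_range]
        rcases Finset.mem_insert.1 hj with rfl | hj
        · omega
        · have := Finset.mem_range.1 (Finset.mem_filter.1 hj).1
          omega
      · rw [Finset.card_insert_of_notMem, ← h]
        intro hj
        have := Finset.mem_range.1 (Finset.mem_filter.1 hj).1
        omega
      · intro j hj
        rcases Finset.mem_insert.1 hj with rfl | hj
        · rw [Function.update_self]
          exact ⟨D S ∩ P, ⟨S, P, hP, rfl⟩, hxS, hxP⟩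
        · exact hcov j (Finset.mem_range.1 (Finset.mem_filter.1 hj).1) (Finset.mem_filter.1 hj).2
    · obtain ⟨J', hJ', hcard⟩ := Finset.exists_subset_card_eq (show n + 1 ≤ J.card from h)
      refine ⟨J', ?_, hcard, ?_⟩
      · intro j hj
        have := Finset.mem_range.1 (Finset.mem_filter.1 (hJ' hj)).1
        rw [Finset.mem_range]; omega
      · intro j hj
        have hj' := Finset.mem_filter.1 (hJ' hj)
        exact hcov j (Finset.mem_range.1 hj'.1) hj'.2

theorem aux_kolm {X Λ : Type*} [TopologicalSpace X] [NormalSpace X] [ParacompactSpace X]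
    (V : Λ → Set X) (hVo : ∀ l, IsOpen (V l)) (hVc : ⋃ l, V l = univ) (k : ℕ)
    (hord : ∀ x, ∀ T : Finset Λ, (∀ l ∈ T, x ∈ V l) → T.card ≤ k + 1) (n : ℕ) :
    ∃ 𝒞, AuxKolm V k (n + 1) 𝒞 := by
  induction n with
  | zero => exact aux_kolm_base V hVo hVc k hord
  | succ n ih =>
    obtain ⟨𝒞, h⟩ := ih
    exact aux_kolm_step V k (n + 1) (by omega) 𝒞 h
/-- `M` is equiconnected in `Y`. -/
def AuxGood {Y : Type*} [TopologicalSpace Y] (M : Set Y) : Prop :=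
  ∃ μ : Y → Y → unitInterval → Y,
    ContinuousOn (fun x : Y × Y × unitInterval => μ x.1 x.2.1 x.2.2) (M ×ˢ M ×ˢ univ) ∧
    ∀ a ∈ M, ∀ b ∈ M, μ a b 0 = a ∧ μ a b 1 = b ∧ ∀ t, μ a a t = a

theorem aux_locallyClosed {Y Z : Type*} [TopologicalSpace Y] [LocallyCompactSpace Y]
    [TopologicalSpace Z] [T2Space Z] (f : Y → Z) (hf : IsEmbedding f) :
    ∃ O : Set Z, IsOpen O ∧ range f ⊆ O ∧ closure (range f) ∩ O ⊆ range f := by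
  have : ∀ y, ∃ O : Set Z, IsOpen O ∧ f y ∈ O ∧ closure (range f) ∩ O ⊆ range f := by
    intro y
    obtain ⟨K, hK, hKn⟩ := exists_compact_mem_nhds y
    rw [hf.nhds_eq_comap, Filter.mem_comap] at hKn
    obtain ⟨t, ht, htK⟩ := hKn
    obtain ⟨O, hOt, hO, hyO⟩ := mem_nhds_iff.1 ht
    refine ⟨O, hO, hyO, ?_⟩
    intro z hz
    have hcl : IsClosed (f '' K) := (hK.image hf.continuous).isClosed
    have h1 : z ∈ closure (range f ∩ O) := by
      rw [inter_comm]; exact hO.inter_closure ⟨hz.2, hz.1⟩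
    have h2 : range f ∩ O ⊆ f '' K := by
      rintro _ ⟨⟨w, rfl⟩, hw⟩
      exact ⟨w, htK (hOt hw), rfl⟩
    exact image_subset_range _ _ (closure_minimal h2 hcl h1)
  choose O hO hyO hOc using this
  refine ⟨⋃ y, O y, isOpen_iUnion hO, ?_, ?_⟩
  · rintro _ ⟨y, rfl⟩; exact mem_iUnion.2 ⟨y, hyO y⟩
  · rintro z ⟨hz, hz'⟩
    obtain ⟨y, hy⟩ := mem_iUnion.1 hz'
    exact hOc y ⟨hz, hy⟩

theorem aux_good {Y : Type u} [MetricSpace Y] [LocallyCompactSpace Y]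
    [TopologicalSpace.SeparableSpace Y] (hANR : IsANR Y) (y0 : Y) :
    ∃ M : Set Y, IsOpen M ∧ y0 ∈ M ∧ AuxGood M := by
  obtain ⟨f, hf⟩ := KuratowskiEmbedding.exists_isometric_embedding Y
  obtain ⟨O, hO, hfO, hOc⟩ := aux_locallyClosed f hf.isEmbedding
  let Z := ULift.{u} ↥O
  let e : Y → Z := fun y => ULift.up ⟨f y, hfO ⟨y, rfl⟩⟩
  let j : Z → _ := fun z => (z.down : _)
  have hj : IsEmbedding (fun z : Z => (z.down : lp (fun _ : ℕ => ℝ) ⊤)) :=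
    IsEmbedding.subtypeVal.comp Homeomorph.ulift.isEmbedding
  have hec : Continuous e := continuous_uliftUp.comp (hf.continuous.subtype_mk _)
  have hee : IsEmbedding e := IsEmbedding.of_comp hec hj.continuous hf.isEmbedding
  have hrange : range e = (fun z : Z => (z.down : lp (fun _ : ℕ => ℝ) ⊤)) ⁻¹' closure (range f) := by
    ext z
    constructor
    · rintro ⟨y, rfl⟩; exact subset_closure ⟨y, rfl⟩
    · intro hz
      obtain ⟨y, hy⟩ := hOc ⟨hz, z.down.2⟩
      exact ⟨y, hj.injective hy⟩
  have hecl : IsClosedEmbedding e := ⟨hee, by rw [hrange]; exact isClosed_closure.preimage hj.continuous⟩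
  obtain ⟨W, r, hW, heW, hr1, hr2⟩ := hANR Z hj.metrizableSpace e hecl
  choose R hR using hr1
  have hRc : Continuous R := by
    rw [hee.continuous_iff]
    have : e ∘ R = r := funext hR
    rw [this]; exact r.continuous
  have hRe : ∀ y h, R ⟨e y, h⟩ = y := fun y h => hee.injective ((hR _).trans (hr2 y h))
  -- W as an open subset of the normed space
  have hj' : IsOpenMap (fun z : Z => (z.down : lp (fun _ : ℕ => ℝ) ⊤)) :=
    hO.isOpenMap_subtype_val.comp Homeomorph.ulift.isOpenMap
  have hWo := hj' W hW
  obtain ⟨ε, hε, hball⟩ := Metric.isOpen_iff.1 hWo (f y0) ⟨e y0, heW ⟨y0, rfl⟩, rfl⟩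
  have hcv : Convex ℝ (Metric.ball (f y0) ε) := convex_ball _ _
  set B := Metric.ball (f y0) ε with hB
  have hBO : ∀ v ∈ B, ∃ h : v ∈ O, (ULift.up ⟨v, h⟩ : Z) ∈ W := by
    intro v hv
    obtain ⟨⟨z, hz⟩, hzW, rfl⟩ := hball hv
    exact ⟨hz, hzW⟩
  let Q : B → Y := fun v => R ⟨ULift.up ⟨v.1, (hBO v.1 v.2).1⟩, (hBO v.1 v.2).2⟩
  have hQ : Continuous Q := by
    refine hRc.comp (Continuous.subtype_mk (continuous_uliftUp.comp ?_) _)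
    exact continuous_subtype_val.subtype_mk _
  have hQf : ∀ y (h : f y ∈ B), Q ⟨f y, h⟩ = y := fun y h => hRe y _
  let seg : Y → Y → unitInterval → lp (fun _ : ℕ => ℝ) ⊤ := fun a b t =>
    AffineMap.lineMap (f a) (f b) (t : ℝ)
  have hseg : ∀ a ∈ f ⁻¹' B, ∀ b ∈ f ⁻¹' B, ∀ t, seg a b t ∈ B := fun a ha b hb t =>
    hcv.lineMap_mem ha hb t.2
  classical
  let μ : Y → Y → unitInterval → Y := fun a b t =>
    if h : seg a b t ∈ B then Q ⟨seg a b t, h⟩ else y0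
  have hμ : ∀ a b t (h : seg a b t ∈ B), μ a b t = Q ⟨seg a b t, h⟩ := fun a b t h => dif_pos h
  have hQ' : ∀ v y (h : v ∈ B), v = f y → Q ⟨v, h⟩ = y := by
    intro v y h hv; subst hv; exact hQf y h
  refine ⟨f ⁻¹' B, Metric.isOpen_ball.preimage hf.continuous, Metric.mem_ball_self hε, μ, ?_, ?_⟩
  · rw [continuousOn_iff_continuous_domRestrict]
    have hm : ∀ x : ((f ⁻¹' B) ×ˢ (f ⁻¹' B) ×ˢ (univ : Set unitInterval) : Set (Y × Y × unitInterval)),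
        seg x.1.1 x.1.2.1 x.1.2.2 ∈ B := fun x => hseg _ x.2.1 _ x.2.2.1 _
    have : (((f ⁻¹' B) ×ˢ (f ⁻¹' B) ×ˢ (univ : Set unitInterval)).domRestrict
        fun x : Y × Y × unitInterval => μ x.1 x.2.1 x.2.2) = fun x => Q ⟨_, hm x⟩ := by
      funext x; exact hμ _ _ _ (hm x)
    rw [this]
    refine hQ.comp (Continuous.subtype_mk ?_ _)
    have hfc := hf.continuous
    simp only [seg, AffineMap.lineMap_apply_module]
    fun_prop
  · intro a ha b hb
    refine ⟨?_, ?_, fun t => ?_⟩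
    · rw [hμ a b 0 (hseg a ha b hb 0)]; exact hQ' _ _ _ (by simp [seg])
    · rw [hμ a b 1 (hseg a ha b hb 1)]; exact hQ' _ _ _ (by simp [seg])
    · rw [hμ a a t (hseg a ha a ha t)]; exact hQ' _ _ _ (by simp [seg])

theorem aux_contract {Y : Type*} [TopologicalSpace Y] (y0 : Y) (M : Set Y) (hMo : IsOpen M) (hy0 : y0 ∈ M)
    (hM : AuxGood M) (O : Set Y) (hO : IsOpen O) (hyO : y0 ∈ O) :
    ∃ (W : Set Y) (c : Y → unitInterval → Y), IsOpen W ∧ y0 ∈ W ∧ W ⊆ O ∧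
      ContinuousOn (fun x : Y × unitInterval => c x.1 x.2) (W ×ˢ univ) ∧
      ∀ p ∈ W, c p 0 = p ∧ c p 1 = y0 ∧ ∀ t, c p t ∈ O := by
  obtain ⟨μ, hμc, hμ⟩ := hM
  have hc : ContinuousOn (fun x : Y × unitInterval => μ x.1 y0 x.2) (M ×ˢ univ) := by
    refine hμc.comp (f := fun x : Y × unitInterval => (x.1, y0, x.2)) (by fun_prop) ?_
    rintro ⟨p, t⟩ ⟨hp, -⟩
    exact ⟨hp, hy0, trivial⟩
  have hN : IsOpen ((M ×ˢ univ) ∩ (fun x : Y × unitInterval => μ x.1 y0 x.2) ⁻¹' O) :=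
    hc.isOpen_inter_preimage (hMo.prod isOpen_univ) hO
  obtain ⟨u, v, hu, hv, hyu, hIv, huv⟩ := generalized_tube_lemma (isCompact_singleton (x := y0))
    (isCompact_univ (X := unitInterval)) hN (by
      rintro ⟨p, t⟩ ⟨hp, -⟩
      rw [mem_singleton_iff] at hp
      simp only at hp
      subst hp
      refine ⟨⟨hy0, trivial⟩, ?_⟩
      show μ p p t ∈ O
      rw [(hμ p hy0 p hy0).2.2 t]; exact hyO)
  have huv' : ∀ p ∈ u, ∀ t, p ∈ M ∧ μ p y0 t ∈ O := by
    intro p hp t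
    have := huv (show (p, t) ∈ u ×ˢ v from ⟨hp, hIv trivial⟩)
    exact ⟨this.1.1, this.2⟩
  refine ⟨u ∩ O, fun p t => μ p y0 t, hu.inter hO, ⟨hyu rfl, hyO⟩, inter_subset_right, ?_, ?_⟩
  · refine hc.mono ?_
    rintro ⟨p, t⟩ ⟨hp, -⟩
    exact ⟨(huv' p hp.1 0).1, trivial⟩
  · intro p hp
    have hpM := (huv' p hp.1 0).1
    exact ⟨(hμ p hpM y0 hy0).1, (hμ p hpM y0 hy0).2.1, fun t => (huv' p hp.1 t).2⟩
/-- Clamping to the unit interval. -/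
noncomputable def auxPr (x : ℝ) : unitInterval := projIcc 0 1 zero_le_one x

theorem auxPr_cont : Continuous auxPr := continuous_projIcc (h := zero_le_one)

theorem auxPr_zero (x : ℝ) (h : x ≤ 0) : auxPr x = 0 := projIcc_of_le_left _ h

theorem auxPr_one (x : ℝ) (h : 1 ≤ x) : auxPr x = 1 := projIcc_of_right_le _ h

theorem auxPr_coe (t : unitInterval) : auxPr t = t := projIcc_val _ t

/-- Three-fold concatenation `f * g * h⁻¹`. -/
noncomputable def auxCat {Y : Type*} (f g h : unitInterval → Y) (t : unitInterval) : Y :=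
  if (t : ℝ) ≤ 1 / 3 then f (auxPr (3 * t)) else
    if (t : ℝ) ≤ 2 / 3 then g (auxPr (3 * t - 1)) else h (auxPr (3 - 3 * t))

theorem auxCat_zero {Y : Type*} (f g h : unitInterval → Y) : auxCat f g h 0 = f 0 := by
  simp [auxCat, auxPr_zero]

theorem auxCat_one {Y : Type*} (f g h : unitInterval → Y) : auxCat f g h 1 = h 0 := by
  have h1 : ¬ ((1 : ℝ) ≤ 1 / 3) := by norm_num
  have h2 : ¬ ((1 : ℝ) ≤ 2 / 3) := by norm_num
  simp only [auxCat, Set.Icc.coe_one, if_neg h1, if_neg h2]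
  rw [auxPr_zero _ (by norm_num)]

theorem auxCat_smul {G Y : Type*} [SMul G Y] (a : G) (f g h : unitInterval → Y) (t : unitInterval) :
    auxCat (fun t => a • f t) (fun t => a • g t) (fun t => a • h t) t = a • auxCat f g h t := by
  unfold auxCat; split_ifs <;> rfl

theorem auxCat_cont {Ω Y : Type*} [TopologicalSpace Ω] [TopologicalSpace Y] (f g h : Ω → unitInterval → Y)
    (hf : Continuous fun x : Ω × unitInterval => f x.1 x.2)
    (hg : Continuous fun x : Ω × unitInterval => g x.1 x.2)
    (hh : Continuous fun x : Ω × unitInterval => h x.1 x.2)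
    (hfg : ∀ w, f w 1 = g w 0) (hgh : ∀ w, g w 1 = h w 1) :
    Continuous fun x : Ω × unitInterval => auxCat (f x.1) (g x.1) (h x.1) x.2 := by
  have hp := auxPr_cont
  unfold auxCat
  have hf' : Continuous fun x : Ω × unitInterval => f x.1 (auxPr (3 * x.2)) :=
    hf.comp (by fun_prop : Continuous fun x : Ω × unitInterval => (x.1, auxPr (3 * x.2)))
  have hg' : Continuous fun x : Ω × unitInterval => g x.1 (auxPr (3 * x.2 - 1)) :=
    hg.comp (by fun_prop : Continuous fun x : Ω × unitInterval => (x.1, auxPr (3 * x.2 - 1)))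
  have hh' : Continuous fun x : Ω × unitInterval => h x.1 (auxPr (3 - 3 * x.2)) :=
    hh.comp (by fun_prop : Continuous fun x : Ω × unitInterval => (x.1, auxPr (3 - 3 * x.2)))
  refine Continuous.if_le hf' (Continuous.if_le hg' hh' (by fun_prop) (by fun_prop) ?_)
    (by fun_prop) (by fun_prop) ?_
  · rintro ⟨w, t⟩ ht
    simp only at ht ⊢
    rw [ht, auxPr_one _ (by norm_num), auxPr_one _ (by norm_num), hgh]
  · rintro ⟨w, t⟩ ht
    simp only at ht ⊢
    rw [ht, if_pos (by norm_num), auxPr_one _ (by norm_num), auxPr_zero _ (by norm_num), hfg]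

theorem aux_contOn_iff {Ω I Y : Type*} [TopologicalSpace Ω] [TopologicalSpace I] [TopologicalSpace Y]
    (F : Ω × I → Y) (D : Set Ω) :
    ContinuousOn F (D ×ˢ univ) ↔ Continuous fun x : D × I => F (x.1, x.2) := by
  constructor
  · intro h
    exact h.comp_continuous (by fun_prop) fun x => ⟨x.1.2, trivial⟩
  · intro h
    rw [continuousOn_iff_continuous_domRestrict]
    exact h.comp (by fun_prop : Continuous fun x : (D ×ˢ univ : Set (Ω × I)) =>
      ((⟨x.1.1, x.2.1⟩ : D), x.1.2))

theorem auxCat_contOn {Ω Y : Type*} [TopologicalSpace Ω] [TopologicalSpace Y] (D : Set Ω)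
    (f g h : Ω → unitInterval → Y)
    (hf : ContinuousOn (fun x : Ω × unitInterval => f x.1 x.2) (D ×ˢ univ))
    (hg : ContinuousOn (fun x : Ω × unitInterval => g x.1 x.2) (D ×ˢ univ))
    (hh : ContinuousOn (fun x : Ω × unitInterval => h x.1 x.2) (D ×ˢ univ))
    (hfg : ∀ w ∈ D, f w 1 = g w 0) (hgh : ∀ w ∈ D, g w 1 = h w 1) :
    ContinuousOn (fun x : Ω × unitInterval => auxCat (f x.1) (g x.1) (h x.1) x.2) (D ×ˢ univ) := by
  rw [aux_contOn_iff] at hf hg hh ⊢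
  exact auxCat_cont (fun w : D => f w) (fun w : D => g w) (fun w : D => h w) hf hg hh
    (fun w => hfg w w.2) (fun w => hgh w w.2)

theorem aux_square {Y : Type*} [TopologicalSpace Y] [SimplyConnectedSpace Y] {a b a' b' : Y}
    (γ : Path a b) (γ' : Path a' b') (e : Path a a') (f : Path b b') :
    ∃ K : unitInterval → unitInterval → Y,
      Continuous (fun x : unitInterval × unitInterval => K x.1 x.2) ∧
      (∀ t, K 0 t = γ t) ∧ (∀ t, K 1 t = γ' t) ∧
      (∀ s : unitInterval, K s 0 = e (auxPr (2 * s))) ∧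
      (∀ s : unitInterval, K s 1 = f (auxPr (2 * s))) := by
  have hp := auxPr_cont
  let trap : unitInterval → unitInterval → Y := fun s t =>
    if (t : ℝ) ≤ s / 3 then e (auxPr (s - 3 * t)) else
      if (t : ℝ) ≤ 1 - s / 3 then γ (auxPr ((t - s / 3) / (1 - 2 * s / 3))) else
        f (auxPr (s - 3 * (1 - t)))
  have hden : ∀ s : unitInterval, (1 - 2 * (s : ℝ) / 3) ≠ 0 := by
    intro s
    have := s.2.2
    have : 0 < (1 - 2 * (s : ℝ) / 3) := by linarith
    exact this.ne'
  have htrap : Continuous fun x : unitInterval × unitInterval => trap x.1 x.2 := by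
    refine Continuous.if_le (by fun_prop) (Continuous.if_le ?_ (by fun_prop) (by fun_prop) (by fun_prop) ?_)
      (by fun_prop) (by fun_prop) ?_
    · refine γ.continuous.comp (hp.comp ?_)
      exact Continuous.div (by fun_prop) (by fun_prop) fun x => hden x.1
    · rintro ⟨s, t⟩ ht
      simp only at ht ⊢
      rw [ht, auxPr_zero (s - 3 * (1 - (1 - s / 3))) (by linarith), auxPr_one]
      · simp
      · rw [show 1 - (s : ℝ) / 3 - s / 3 = 1 - 2 * s / 3 by ring, div_self (hden s)]
    · rintro ⟨s, t⟩ ht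
      simp only at ht ⊢
      have := s.2.2
      rw [ht, if_pos (by linarith), auxPr_zero (s - 3 * (s / 3)) (by linarith), auxPr_zero]
      · simp
      · simp
  have ht0 : ∀ s, trap s 0 = e s := by
    intro s
    have := s.2.1
    have h : (((0 : unitInterval) : ℝ) ≤ s / 3) := by rw [Set.Icc.coe_zero]; linarith
    simp only [trap, if_pos h]
    rw [Set.Icc.coe_zero, mul_zero, sub_zero, auxPr_coe]
  have ht1 : ∀ s, trap s 1 = f s := by
    intro s
    have h0 := s.2.1
    have h1 := s.2.2
    have h : ¬ (((1 : unitInterval) : ℝ) ≤ s / 3) := by rw [Set.Icc.coe_one]; linarith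
    simp only [trap, if_neg h]
    split_ifs with h'
    · rw [Set.Icc.coe_one] at h'
      have hs : s = 0 := Subtype.ext (by show (s : ℝ) = 0; linarith)
      subst hs
      simp [auxPr_one]
    · rw [Set.Icc.coe_one, sub_self, mul_zero, sub_zero, auxPr_coe]
  have hs0 : ∀ t, trap 0 t = γ t := by
    intro t
    have h0 := t.2.1
    have h1 := t.2.2
    simp only [trap, Set.Icc.coe_zero, zero_div, sub_zero, mul_zero, div_one]
    split_ifs with h
    · have hs : t = 0 := Subtype.ext (by show (t : ℝ) = 0; linarith)
      subst hs
      simp [auxPr_zero]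
    · rw [auxPr_coe]
  let δ : Path a' b' :=
    { toFun := trap 1
      continuous_toFun := htrap.comp (by fun_prop : Continuous fun t : unitInterval => ((1 : unitInterval), t))
      source' := by rw [ht0]; simp
      target' := by rw [ht1]; simp }
  obtain ⟨G⟩ := SimplyConnectedSpace.paths_homotopic δ γ'
  refine ⟨fun s t => if (s : ℝ) ≤ 1 / 2 then trap (auxPr (2 * s)) t else G (auxPr (2 * s - 1), t), ?_, ?_, ?_, ?_, ?_⟩
  · refine Continuous.if_le ?_ (by fun_prop) (by fun_prop) (by fun_prop) ?_
    · exact htrap.comp (by fun_prop : Continuous fun x : unitInterval × unitInterval =>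
        (auxPr (2 * x.1), x.2))
    · rintro ⟨s, t⟩ hs
      simp only at hs ⊢
      rw [hs, auxPr_one _ (by norm_num), auxPr_zero _ (by norm_num), G.apply_zero]
      rfl
  · intro t
    simp only [Set.Icc.coe_zero, mul_zero]
    rw [if_pos (by norm_num), auxPr_zero _ le_rfl, hs0]
  · intro t
    simp only [Set.Icc.coe_one]
    rw [if_neg (by norm_num), auxPr_one _ (by norm_num), G.apply_one]
    rfl
  · intro s
    simp only
    split_ifs with h
    · rw [ht0]
    · rw [auxPr_one (2 * s) (by linarith), G.source]; simp
  · intro s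
    simp only
    split_ifs with h
    · rw [ht1]
    · rw [auxPr_one (2 * s) (by linarith), G.target]; simp

theorem aux_homotopy {Y : Type*} [TopologicalSpace Y] [SimplyConnectedSpace Y] (T T' M M' : Set Y)
    (hT : T.Nonempty) (hT' : T'.Nonempty)
    (hM : AuxGood M) (hM' : AuxGood M') (c c' d d' : Y → unitInterval → Y) {a a' b b' : Y}
    (hc : ContinuousOn (fun x : Y × unitInterval => c x.1 x.2) (T ×ˢ univ))
    (hc' : ContinuousOn (fun x : Y × unitInterval => c' x.1 x.2) (T ×ˢ univ))
    (hd : ContinuousOn (fun x : Y × unitInterval => d x.1 x.2) (T' ×ˢ univ))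
    (hd' : ContinuousOn (fun x : Y × unitInterval => d' x.1 x.2) (T' ×ˢ univ))
    (hcp : ∀ p ∈ T, c p 0 = p ∧ c p 1 = a ∧ ∀ t, c p t ∈ M)
    (hcp' : ∀ p ∈ T, c' p 0 = p ∧ c' p 1 = a' ∧ ∀ t, c' p t ∈ M)
    (hdp : ∀ p ∈ T', d p 0 = p ∧ d p 1 = b ∧ ∀ t, d p t ∈ M')
    (hdp' : ∀ p ∈ T', d' p 0 = p ∧ d' p 1 = b' ∧ ∀ t, d' p t ∈ M')
    (γ : Path a b) (γ' : Path a' b') :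
    ∃ S : unitInterval → Y → Y → unitInterval → Y,
      ContinuousOn (fun x : ((Y × Y) × unitInterval) × unitInterval => S x.1.2 x.1.1.1 x.1.1.2 x.2)
        (((T ×ˢ T') ×ˢ univ) ×ˢ univ) ∧
      ∀ p ∈ T, ∀ r ∈ T', (∀ t, S 0 p r t = auxCat (c p) γ (d r) t) ∧
        (∀ t, S 1 p r t = auxCat (c' p) γ' (d' r) t) ∧ ∀ s, S s p r 0 = p ∧ S s p r 1 = r := by
  have hp := auxPr_cont
  obtain ⟨μ, hμc, hμ⟩ := hM
  obtain ⟨ν, hνc, hν⟩ := hM'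
  obtain ⟨p0, hp0⟩ := hT
  obtain ⟨q0, hq0⟩ := hT'
  have ha : a ∈ M := (hcp p0 hp0).2.1 ▸ (hcp p0 hp0).2.2 1
  have ha' : a' ∈ M := (hcp' p0 hp0).2.1 ▸ (hcp' p0 hp0).2.2 1
  have hb : b ∈ M' := (hdp q0 hq0).2.1 ▸ (hdp q0 hq0).2.2 1
  have hb' : b' ∈ M' := (hdp' q0 hq0).2.1 ▸ (hdp' q0 hq0).2.2 1
  let e : Path a a' :=
    { toFun := fun t => μ a a' t
      continuous_toFun := hμc.comp_continuous
        (by fun_prop : Continuous fun t : unitInterval => (a, a', t)) fun t => ⟨ha, ha', trivial⟩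
      source' := (hμ a ha a' ha').1
      target' := (hμ a ha a' ha').2.1 }
  let f : Path b b' :=
    { toFun := fun t => ν b b' t
      continuous_toFun := hνc.comp_continuous
        (by fun_prop : Continuous fun t : unitInterval => (b, b', t)) fun t => ⟨hb, hb', trivial⟩
      source' := (hν b hb b' hb').1
      target' := (hν b hb b' hb').2.1 }
  obtain ⟨K, hK, hK0, hK1, hKe, hKf⟩ := aux_square γ γ' e f
  refine ⟨fun s p r t => auxCat (fun t => μ (c p t) (c' p t) (auxPr (2 * s))) (K s)
    (fun t => ν (d r t) (d' r t) (auxPr (2 * s))) t, ?_, ?_⟩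
  · refine auxCat_contOn ((T ×ˢ T') ×ˢ (univ : Set unitInterval))
      (fun w t => μ (c w.1.1 t) (c' w.1.1 t) (auxPr (2 * w.2))) (fun w => K w.2)
      (fun w t => ν (d w.1.2 t) (d' w.1.2 t) (auxPr (2 * w.2))) ?_ ?_ ?_ ?_ ?_
    · have h1 : ContinuousOn (fun x : ((Y × Y) × unitInterval) × unitInterval => c x.1.1.1 x.2)
          (((T ×ˢ T') ×ˢ univ) ×ˢ univ) :=
        hc.comp (f := fun x : ((Y × Y) × unitInterval) × unitInterval => (x.1.1.1, x.2)) (by fun_prop)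
          fun x hx => ⟨hx.1.1.1, trivial⟩
      have h2 : ContinuousOn (fun x : ((Y × Y) × unitInterval) × unitInterval => c' x.1.1.1 x.2)
          (((T ×ˢ T') ×ˢ univ) ×ˢ univ) :=
        hc'.comp (f := fun x : ((Y × Y) × unitInterval) × unitInterval => (x.1.1.1, x.2)) (by fun_prop)
          fun x hx => ⟨hx.1.1.1, trivial⟩
      exact hμc.comp (f := fun x : ((Y × Y) × unitInterval) × unitInterval =>
        (c x.1.1.1 x.2, c' x.1.1.1 x.2, auxPr (2 * x.1.2)))
        (h1.prodMk (h2.prodMk (by fun_prop)))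
        fun x hx => ⟨(hcp _ hx.1.1.1).2.2 _, (hcp' _ hx.1.1.1).2.2 _, trivial⟩
    · exact (hK.comp (by fun_prop : Continuous fun x : ((Y × Y) × unitInterval) × unitInterval =>
        (x.1.2, x.2))).continuousOn
    · have h1 : ContinuousOn (fun x : ((Y × Y) × unitInterval) × unitInterval => d x.1.1.2 x.2)
          (((T ×ˢ T') ×ˢ univ) ×ˢ univ) :=
        hd.comp (f := fun x : ((Y × Y) × unitInterval) × unitInterval => (x.1.1.2, x.2)) (by fun_prop)
          fun x hx => ⟨hx.1.1.2, trivial⟩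
      have h2 : ContinuousOn (fun x : ((Y × Y) × unitInterval) × unitInterval => d' x.1.1.2 x.2)
          (((T ×ˢ T') ×ˢ univ) ×ˢ univ) :=
        hd'.comp (f := fun x : ((Y × Y) × unitInterval) × unitInterval => (x.1.1.2, x.2)) (by fun_prop)
          fun x hx => ⟨hx.1.1.2, trivial⟩
      exact hνc.comp (f := fun x : ((Y × Y) × unitInterval) × unitInterval =>
        (d x.1.1.2 x.2, d' x.1.1.2 x.2, auxPr (2 * x.1.2)))
        (h1.prodMk (h2.prodMk (by fun_prop)))
        fun x hx => ⟨(hdp _ hx.1.1.2).2.2 _, (hdp' _ hx.1.1.2).2.2 _, trivial⟩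
    · rintro ⟨⟨p, r⟩, s⟩ ⟨⟨h1, h2⟩, -⟩
      simp only at h1 h2 ⊢
      rw [hKe, (hcp p h1).2.1, (hcp' p h1).2.1]; rfl
    · rintro ⟨⟨p, r⟩, s⟩ ⟨⟨h1, h2⟩, -⟩
      simp only at h1 h2 ⊢
      rw [hKf, (hdp r h2).2.1, (hdp' r h2).2.1]; rfl
  · intro p h1 r h2
    have hA := fun t => hμ _ ((hcp p h1).2.2 t) _ ((hcp' p h1).2.2 t)
    have hB := fun t => hν _ ((hdp r h2).2.2 t) _ ((hdp' r h2).2.2 t)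
    refine ⟨fun t => ?_, fun t => ?_, fun s => ⟨?_, ?_⟩⟩
    · have e0 : auxPr (2 * ((0 : unitInterval) : ℝ)) = 0 := auxPr_zero _ (by simp)
      simp only [e0]
      congr 1
      · funext t; exact (hA t).1
      · funext t; exact hK0 t
      · funext t; exact (hB t).1
    · have e0 : auxPr (2 * ((1 : unitInterval) : ℝ)) = 1 := auxPr_one _ (by simp)
      simp only [e0]
      congr 1
      · funext t; exact (hA t).2.1
      · funext t; exact hK1 t
      · funext t; exact (hB t).2.1
    · show auxCat _ _ _ 0 = p
      rw [auxCat_zero]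
      simp only [(hcp p h1).1, (hcp' p h1).1]
      have hpM : p ∈ M := by have := (hcp p h1).2.2 0; rwa [(hcp p h1).1] at this
      exact (hμ p hpM p hpM).2.2 _
    · show auxCat _ _ _ 1 = r
      rw [auxCat_one]
      simp only [(hdp r h2).1, (hdp' r h2).1]
      have hpM : r ∈ M' := by have := (hdp r h2).2.2 0; rwa [(hdp r h2).1] at this
      exact (hν r hpM r hpM).2.2 _
theorem auxGood_smul {π Y : Type*} [Group π] [TopologicalSpace Y] [MulAction π Y] [ContinuousConstSMul π Y]
    (M : Set Y) (hM : AuxGood M) (g : π) : AuxGood {p : Y | g⁻¹ • p ∈ M} := by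
  obtain ⟨μ, hc, h⟩ := hM
  refine ⟨fun a b t => g • μ (g⁻¹ • a) (g⁻¹ • b) t, ?_, ?_⟩
  · refine ContinuousOn.const_smul (c := g) ?_
    exact hc.comp (f := fun x : Y × Y × unitInterval => (g⁻¹ • x.1, g⁻¹ • x.2.1, x.2.2))
      (by fun_prop) fun x hx => ⟨hx.1, hx.2.1, trivial⟩
  · intro a ha b hb
    obtain ⟨h1, h2, -⟩ := h _ ha _ hb
    refine ⟨?_, ?_, fun t => ?_⟩
    · simp [h1]
    · simp [h2]
    · simp [(h _ ha _ ha).2.2]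

theorem aux_quot {π Y : Type u} [Group π] [MetricSpace Y] [LocallyCompactSpace Y] [ConnectedSpace Y]
    [MulAction π Y] [ContinuousConstSMul π Y]
    (hproper : ∀ C : Set Y, IsCompact C → {g : π | ((g • C) ∩ C).Nonempty}.Finite) :
    ∃ (X : Type u) (_ : TopologicalSpace X) (q : Y → X), SecondCountableTopology Y ∧
      ProperlyDiscontinuousSMul π Y ∧ T2Space X ∧
      SecondCountableTopology X ∧ TopologicalSpace.MetrizableSpace X ∧ Continuous q ∧ IsOpenMap q ∧
      Function.Surjective q ∧ ∀ y y', q y = q y' ↔ ∃ g : π, g • y = y' := by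
  have hpd : ProperlyDiscontinuousSMul π Y := by
    constructor
    intro K L hK hL
    refine (hproper _ (hK.union hL)).subset ?_
    rintro g ⟨_, ⟨x, hx, rfl⟩, hL'⟩
    exact ⟨g • x, Set.smul_mem_smul_set (Or.inl hx), Or.inr hL'⟩
  have hsc : SigmaCompactSpace Y := aux_sigmaCompact Y
  have hYsc : SecondCountableTopology Y := EMetric.secondCountable_of_sigmaCompact Y
  have hX2 : SecondCountableTopology (Quotient (MulAction.orbitRel π Y)) :=
    ContinuousConstSMul.secondCountableTopology
  have hX : T2Space (Quotient (MulAction.orbitRel π Y)) := inferInstance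
  have hq := MulAction.isOpenQuotientMap_quotientMk (Γ := π) (T := Y)
  have hlc : LocallyCompactSpace (Quotient (MulAction.orbitRel π Y)) :=
    hq.locallyCompactSpace
  refine ⟨Quotient (MulAction.orbitRel π Y), inferInstance, Quotient.mk _, hYsc, hpd, hX, hX2,
    TopologicalSpace.metrizableSpace_of_t3_secondCountable _, hq.continuous, hq.isOpenMap, hq.surjective, ?_⟩
  intro y y'
  rw [Quotient.eq, MulAction.orbitRel_apply, MulAction.mem_orbit_iff]
  constructor
  · rintro ⟨g, hg⟩; exact ⟨g⁻¹, by rw [← hg]; simp⟩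
  · rintro ⟨g, hg⟩; exact ⟨g⁻¹, by rw [← hg]; simp⟩

theorem aux_star {π Y X : Type*} [Group π] [TopologicalSpace Y] [MulAction π Y] [ContinuousConstSMul π Y]
    [TopologicalSpace X] [T2Space X] [ParacompactSpace X] (q : Y → X) (hq : Continuous q)
    (hqo : IsOpenMap q) (hqs : Function.Surjective q)
    (hqe : ∀ y y', q y = q y' ↔ ∃ g : π, g • y = y')
    (G : Y → Set Y) (hGo : ∀ y, IsOpen (G y)) (hyG : ∀ y, y ∈ G y)
    (hGd : ∀ y (g : π) w, w ∈ G y → g • w ∈ G y → g = 1) (hGg : ∀ y, AuxGood (G y)) :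
    ∃ O : Y → Set Y, (∀ y, IsOpen (O y)) ∧ (∀ y, y ∈ O y) ∧ (∀ y, O y ⊆ G y) ∧
      ∀ (g h : π) y y' w, g⁻¹ • w ∈ O y → h⁻¹ • w ∈ O y' →
        ∃ M, AuxGood M ∧ (∀ p, g⁻¹ • p ∈ O y → p ∈ M) ∧ (∀ p, h⁻¹ • p ∈ O y' → p ∈ M) := by
  have hcov : ⋃ y, q '' G y = univ := by
    refine eq_univ_of_forall fun x => ?_
    obtain ⟨y, rfl⟩ := hqs x
    exact mem_iUnion.2 ⟨y, y, hyG y, rfl⟩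
  obtain ⟨v, hvo, hvc, hvl, hvs⟩ := precise_refinement (fun y => q '' G y) (fun y => hqo _ (hGo y)) hcov
  obtain ⟨E, hEc, hEcl, hEv⟩ := exists_iUnion_eq_closed_subset hvo hvl.point_finite hvc
  have hEl : LocallyFinite E := hvl.subset hEv
  have hqinv : ∀ (g : π) y, q (g • y) = q y := fun g y => ((hqe _ _).2 ⟨g, rfl⟩).symm
  have ha : ∀ z y, ∃ a : π, q y ∈ E z → a⁻¹ • y ∈ G z := by
    intro z y
    by_cases h : q y ∈ E z
    · obtain ⟨w, hw, e⟩ := hvs z (hEv z h)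
      obtain ⟨g, rfl⟩ := (hqe _ _).1 e
      exact ⟨g, fun _ => by simpa using hw⟩
    · exact ⟨1, fun h' => absurd h' h⟩
  choose a ha using ha
  have hfin : ∀ y, {z | q y ∈ E z}.Finite := fun y => hEl.point_finite (q y)
  refine ⟨fun y => G y ∩ ((⋂ z ∈ {z | q y ∈ E z}, {p | (a z y)⁻¹ • p ∈ G z}) ∩
    (q ⁻¹' (⋃ z : {z // q y ∉ E z}, E z)ᶜ)), ?_, ?_, ?_, ?_⟩
  · intro y
    refine (hGo y).inter (IsOpen.inter ?_ ?_)
    · exact (hfin y).isOpen_biInter fun z _ => (hGo z).preimage (continuous_const_smul _)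
    · refine IsOpen.preimage hq (isOpen_compl_iff.2 ?_)
      exact (hEl.comp_injective Subtype.val_injective).isClosed_iUnion fun z => hEcl _
  · intro y
    refine ⟨hyG y, mem_iInter₂.2 fun z hz => ha z y hz, ?_⟩
    intro h
    obtain ⟨z, hz⟩ := mem_iUnion.1 h
    exact z.2 hz
  · exact fun y p hp => hp.1
  · intro g h y y' w hw hw'
    have hx : q w ∈ ⋃ z, E z := by rw [hEc]; trivial
    obtain ⟨z, hz⟩ := mem_iUnion.1 hx
    have key : ∀ y (g : π), g⁻¹ • w ∈ (q ⁻¹' (⋃ z : {z // q y ∉ E z}, E z)ᶜ) → q y ∈ E z := by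
      intro y g hg
      by_contra hn
      exact hg (mem_iUnion.2 ⟨⟨z, hn⟩, by rw [hqinv]; exact hz⟩)
    have k1 := key y g hw.2.2
    have k2 := key y' h hw'.2.2
    have m1 : (a z y)⁻¹ • g⁻¹ • w ∈ G z := mem_iInter₂.1 hw.2.1 z k1
    have m2 : (a z y')⁻¹ • h⁻¹ • w ∈ G z := mem_iInter₂.1 hw'.2.1 z k2
    have e : (a z y')⁻¹ * h⁻¹ * (g * a z y) = 1 := by
      refine hGd z _ _ m1 ?_
      convert m2 using 1
      simp [mul_smul]
    have e' : g * a z y = h * a z y' := by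
      rw [← mul_inv_rev, inv_mul_eq_one] at e
      exact e.symm
    refine ⟨{p | (g * a z y)⁻¹ • p ∈ G z}, auxGood_smul _ (hGg z) _, ?_, ?_⟩
    · intro p hp
      have : (a z y)⁻¹ • g⁻¹ • p ∈ G z := mem_iInter₂.1 hp.2.1 z k1
      show (g * a z y)⁻¹ • p ∈ G z
      rwa [mul_inv_rev, mul_smul]
    · intro p hp
      have : (a z y')⁻¹ • h⁻¹ • p ∈ G z := mem_iInter₂.1 hp.2.1 z k2
      show (g * a z y)⁻¹ • p ∈ G z
      rwa [e', mul_inv_rev, mul_smul]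
/-- Equivariant family of contractible labelled neighbourhoods. -/
structure AuxLab (π L Y : Type*) [Group π] [MulAction π L] [TopologicalSpace Y] [MulAction π Y] where
  n : L → π
  W : L → Set Y
  c : L → Y → unitInterval → Y
  cen : L → Y
  hn : ∀ (h : π) a, n (h • a) = h * n a
  hWo : ∀ a, IsOpen (W a)
  hW : ∀ (h : π) a p, p ∈ W a → h • p ∈ W (h • a)
  hdisj : ∀ (h : π) a p, p ∈ W a → p ∈ W (h • a) → h = 1
  hcov : ∀ p, ∃ a, p ∈ W a
  hc : ∀ a, ContinuousOn (fun x : Y × unitInterval => c a x.1 x.2) (W a ×ˢ univ)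
  hc0 : ∀ a p, p ∈ W a → c a p 0 = p
  hc1 : ∀ a p, p ∈ W a → c a p 1 = cen a
  hcs : ∀ (h : π) a p t, c (h • a) (h • p) t = h • c a p t
  hcen : ∀ (h : π) a, cen (h • a) = h • cen a
  star : ∀ a b p, p ∈ W a → p ∈ W b → ∃ M, AuxGood M ∧ (∀ p ∈ W a, ∀ t, c a p t ∈ M) ∧
    (∀ p ∈ W b, ∀ t, c b p t ∈ M)

theorem aux_sec {π L Y : Type*} [Group π] [MulAction π L] [TopologicalSpace Y] [MulAction π Y]
    [ContinuousConstSMul π Y] [SimplyConnectedSpace Y] (D : AuxLab π L Y) :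
    ∃ (sec : L → L → Y → Y → unitInterval → Y)
      (S : L → L → L → L → unitInterval → Y → Y → unitInterval → Y),
      (∀ a b, ContinuousOn (fun x : (Y × Y) × unitInterval => sec a b x.1.1 x.1.2 x.2)
        ((D.W a ×ˢ D.W b) ×ˢ univ)) ∧
      (∀ a b p r, p ∈ D.W a → r ∈ D.W b → sec a b p r 0 = p ∧ sec a b p r 1 = r) ∧
      (∀ (h : π) a b p r t, sec (h • a) (h • b) (h • p) (h • r) t = h • sec a b p r t) ∧
      (∀ a a' b b', ContinuousOn
        (fun x : ((Y × Y) × unitInterval) × unitInterval => S a a' b b' x.1.2 x.1.1.1 x.1.1.2 x.2)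
        ((((D.W a ∩ D.W a') ×ˢ (D.W b ∩ D.W b')) ×ˢ univ) ×ˢ univ)) ∧
      (∀ a a' b b' p r, p ∈ D.W a ∩ D.W a' → r ∈ D.W b ∩ D.W b' →
        (∀ t, S a a' b b' 0 p r t = sec a b p r t) ∧ (∀ t, S a a' b b' 1 p r t = sec a' b' p r t) ∧
        ∀ s, S a a' b b' s p r 0 = p ∧ S a a' b b' s p r 1 = r) ∧
      (∀ (h : π) a a' b b' s p r t,
        S (h • a) (h • a') (h • b) (h • b') s (h • p) (h • r) t = h • S a a' b b' s p r t) := by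
  have : PathConnectedSpace Y := inferInstance
  let γ0 : ∀ a b : L, Path (D.cen a) (D.cen b) := fun a b => PathConnectedSpace.somePath _ _
  let γ : L → L → unitInterval → Y := fun a b t => D.n a • γ0 ((D.n a)⁻¹ • a) ((D.n a)⁻¹ • b) t
  have hnorm : ∀ (h : π) (a b : L), (D.n (h • a))⁻¹ • h • b = (D.n a)⁻¹ • b := by
    intro h a b
    rw [D.hn, mul_inv_rev, mul_smul, inv_smul_smul]
  have hnormY : ∀ (h : π) (a : L) (b : Y), (D.n (h • a))⁻¹ • h • b = (D.n a)⁻¹ • b := by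
    intro h a b
    rw [D.hn, mul_inv_rev, mul_smul, inv_smul_smul]
  have hγs : ∀ (h : π) a b t, γ (h • a) (h • b) t = h • γ a b t := by
    intro h a b t
    have e : ∀ a b a' b' t, a = a' → b = b' → γ0 a b t = γ0 a' b' t := by
      rintro a b _ _ t rfl rfl; rfl
    simp only [γ]
    rw [e _ _ _ _ t (hnorm h a a) (hnorm h a b), D.hn, mul_smul]
  have hγc : ∀ a b, Continuous (γ a b) := fun a b =>
    (γ0 ((D.n a)⁻¹ • a) ((D.n a)⁻¹ • b)).continuous.const_smul _
  have hγ0 : ∀ a b, γ a b 0 = D.cen a := fun a b => by simp [γ, D.hcen]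
  have hγ1 : ∀ a b, γ a b 1 = D.cen b := fun a b => by simp [γ, D.hcen]
  let sec : L → L → Y → Y → unitInterval → Y := fun a b p r t => auxCat (D.c a p) (γ a b) (D.c b r) t
  have hsecs : ∀ (h : π) a b p r t, sec (h • a) (h • b) (h • p) (h • r) t = h • sec a b p r t := by
    intro h a b p r t
    simp only [sec]
    rw [← auxCat_smul]
    congr 1
    · funext t; exact D.hcs _ _ _ _
    · funext t; exact hγs _ _ _ _
    · funext t; exact D.hcs _ _ _ _
  have hS0 : ∀ a a' b b', ∃ S : unitInterval → Y → Y → unitInterval → Y,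
      ContinuousOn
        (fun x : ((Y × Y) × unitInterval) × unitInterval => S x.1.2 x.1.1.1 x.1.1.2 x.2)
        ((((D.W a ∩ D.W a') ×ˢ (D.W b ∩ D.W b')) ×ˢ univ) ×ˢ univ) ∧
      (∀ p ∈ D.W a ∩ D.W a', ∀ r ∈ D.W b ∩ D.W b',
        (∀ t, S 0 p r t = sec a b p r t) ∧ (∀ t, S 1 p r t = sec a' b' p r t) ∧
        ∀ s, S s p r 0 = p ∧ S s p r 1 = r) := by
    intro a a' b b'
    by_cases hne : (D.W a ∩ D.W a').Nonempty
    swap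
    · rw [not_nonempty_iff_eq_empty] at hne
      exact ⟨fun _ p _ _ => p, by fun_prop, by simp [hne]⟩
    by_cases hne' : (D.W b ∩ D.W b').Nonempty
    swap
    · rw [not_nonempty_iff_eq_empty] at hne'
      exact ⟨fun _ p _ _ => p, by fun_prop, by simp [hne']⟩
    obtain ⟨M, hM, hMa, hMa'⟩ := D.star a a' _ hne.some_mem.1 hne.some_mem.2
    obtain ⟨M', hM', hMb, hMb'⟩ := D.star b b' _ hne'.some_mem.1 hne'.some_mem.2
    exact aux_homotopy (D.W a ∩ D.W a') (D.W b ∩ D.W b') M M' hne hne' hM hM'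
      (D.c a) (D.c a') (D.c b) (D.c b') (a := D.cen a) (a' := D.cen a') (b := D.cen b) (b' := D.cen b')
      ((D.hc a).mono (prod_mono inter_subset_left subset_rfl))
      ((D.hc a').mono (prod_mono inter_subset_right subset_rfl))
      ((D.hc b).mono (prod_mono inter_subset_left subset_rfl))
      ((D.hc b').mono (prod_mono inter_subset_right subset_rfl))
      (fun p hp => ⟨D.hc0 _ _ hp.1, D.hc1 _ _ hp.1, hMa p hp.1⟩)
      (fun p hp => ⟨D.hc0 _ _ hp.2, D.hc1 _ _ hp.2, hMa' p hp.2⟩)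
      (fun p hp => ⟨D.hc0 _ _ hp.1, D.hc1 _ _ hp.1, hMb p hp.1⟩)
      (fun p hp => ⟨D.hc0 _ _ hp.2, D.hc1 _ _ hp.2, hMb' p hp.2⟩)
      ⟨⟨γ a b, hγc a b⟩, hγ0 a b, hγ1 a b⟩ ⟨⟨γ a' b', hγc a' b'⟩, hγ0 a' b', hγ1 a' b'⟩
  choose S0 hS0c hS0p using hS0
  have hmem : ∀ (g : π) a a' p, p ∈ D.W a ∩ D.W a' → g • p ∈ D.W (g • a) ∩ D.W (g • a') :=
    fun g a a' p hp => ⟨D.hW _ _ _ hp.1, D.hW _ _ _ hp.2⟩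
  refine ⟨sec, fun a a' b b' s p r t => D.n a • S0 ((D.n a)⁻¹ • a) ((D.n a)⁻¹ • a') ((D.n a)⁻¹ • b)
    ((D.n a)⁻¹ • b') s ((D.n a)⁻¹ • p) ((D.n a)⁻¹ • r) t, ?_, ?_, hsecs, ?_, ?_, ?_⟩
  · intro a b
    refine auxCat_contOn (D.W a ×ˢ D.W b) (fun w => D.c a w.1) (fun w => γ a b) (fun w => D.c b w.2) ?_ ?_ ?_ ?_ ?_
    · exact (D.hc a).comp (f := fun x : (Y × Y) × unitInterval => (x.1.1, x.2)) (by fun_prop)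
        fun x hx => ⟨hx.1.1, trivial⟩
    · exact ((hγc a b).comp continuous_snd).continuousOn
    · exact (D.hc b).comp (f := fun x : (Y × Y) × unitInterval => (x.1.2, x.2)) (by fun_prop)
        fun x hx => ⟨hx.1.2, trivial⟩
    · intro w hw; rw [D.hc1 _ _ hw.1, hγ0]
    · intro w hw; rw [D.hc1 _ _ hw.2, hγ1]
  · intro a b p r hp hr
    exact ⟨(auxCat_zero _ _ _).trans (D.hc0 _ _ hp), (auxCat_one _ _ _).trans (D.hc0 _ _ hr)⟩
  · intro a a' b b'
    refine ContinuousOn.const_smul (c := D.n a) ?_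
    exact (hS0c ((D.n a)⁻¹ • a) ((D.n a)⁻¹ • a') ((D.n a)⁻¹ • b) ((D.n a)⁻¹ • b')).comp
      (f := fun x : ((Y × Y) × unitInterval) × unitInterval =>
        ((((D.n a)⁻¹ • x.1.1.1, (D.n a)⁻¹ • x.1.1.2), x.1.2), x.2)) (by fun_prop)
      fun x hx => ⟨⟨⟨hmem _ _ _ _ hx.1.1.1, hmem _ _ _ _ hx.1.1.2⟩, trivial⟩, trivial⟩
  · intro a a' b b' p r hp hr
    obtain ⟨h1, h2, h3⟩ := hS0p _ _ _ _ _ (hmem (D.n a)⁻¹ a a' p hp) _ (hmem (D.n a)⁻¹ b b' r hr)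
    refine ⟨fun t => ?_, fun t => ?_, fun s => ⟨?_, ?_⟩⟩
    · simp only [h1, hsecs, smul_inv_smul]
    · simp only [h2, hsecs, smul_inv_smul]
    · simp only [(h3 s).1, smul_inv_smul]
    · simp only [(h3 s).2, smul_inv_smul]
  · intro h a a' b b' s p r t
    simp only [hnorm, hnormY]
    rw [D.hn, mul_smul]
theorem aux_colour {π L Y X : Type*} [Group π] [MulAction π L] [TopologicalSpace Y] [MulAction π Y]
    (D : AuxLab π L Y) [TopologicalSpace X] (q : Y → X) (hq : Continuous q)
    (hqe : ∀ y y', q y = q y' ↔ ∃ g : π, g • y = y') (𝒞 : Set (Set X))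
    (ho : ∀ P ∈ 𝒞, IsOpen P) (hs : ∀ P ∈ 𝒞, ∃ a, P ⊆ q '' D.W a)
    (hd : ∀ P ∈ 𝒞, ∀ P' ∈ 𝒞, (P ∩ P').Nonempty → P = P') :
    ∃ l : Y → L, ∀ p, q p ∈ ⋃₀ 𝒞 → p ∈ D.W (l p) ∧ (∀ h : π, l (h • p) = h • l p) ∧
      ∀ᶠ p' in 𝓝 p, l p' = l p := by
  classical
  by_cases hL : Nonempty L
  swap
  · refine ⟨fun p => absurd ⟨(D.hcov p).choose⟩ hL, fun p => absurd ⟨(D.hcov p).choose⟩ hL⟩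
  have hqinv : ∀ (g : π) y, q (g • y) = q y := fun g y => ((hqe _ _).2 ⟨g, rfl⟩).symm
  have h1 : ∀ P, ∃ a, P ∈ 𝒞 → P ⊆ q '' D.W a := by
    intro P
    by_cases h : P ∈ 𝒞
    · obtain ⟨a, ha⟩ := hs P h
      exact ⟨a, fun _ => ha⟩
    · exact ⟨hL.some, fun h' => absurd h' h⟩
  choose a ha using h1
  have h2 : ∀ p, ∃ b, q p ∈ ⋃₀ 𝒞 → ∃ P ∈ 𝒞, q p ∈ P ∧ ∃ g : π, p ∈ D.W (g • a P) ∧ b = g • a P := by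
    intro p
    by_cases h : q p ∈ ⋃₀ 𝒞
    · obtain ⟨P, hP, hp⟩ := h
      obtain ⟨w, hw, e⟩ := ha P hP hp
      obtain ⟨g, rfl⟩ := (hqe _ _).1 e
      exact ⟨g • a P, fun _ => ⟨P, hP, hp, g, D.hW _ _ _ hw, rfl⟩⟩
    · exact ⟨hL.some, fun h' => absurd h' h⟩
  choose l hl using h2
  have key : ∀ p P (g : π), P ∈ 𝒞 → q p ∈ P → p ∈ D.W (g • a P) → l p = g • a P := by
    intro p P g hP hp hg
    obtain ⟨P', hP', hp', g', hg', e⟩ := hl p ⟨P, hP, hp⟩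
    obtain rfl := hd P hP P' hP' ⟨_, hp, hp'⟩
    rw [e]
    have : g * g'⁻¹ = 1 := by
      refine D.hdisj _ (g' • a P) p hg' ?_
      rwa [smul_smul, inv_mul_cancel_right]
    rw [mul_inv_eq_one] at this
    rw [this]
  refine ⟨l, fun p hp => ?_⟩
  obtain ⟨P, hP, hp, g, hg, e⟩ := hl p hp
  rw [e]
  refine ⟨hg, fun h => ?_, ?_⟩
  · rw [smul_smul]
    refine key _ _ _ hP (by rwa [hqinv]) ?_
    rw [mul_smul]
    exact D.hW _ _ _ hg
  · have e1 : ∀ᶠ p' in 𝓝 p, q p' ∈ P := hq.continuousAt.eventually_mem ((ho P hP).mem_nhds hp)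
    have e2 : ∀ᶠ p' in 𝓝 p, p' ∈ D.W (g • a P) := (D.hWo _).mem_nhds hg
    filter_upwards [e1, e2] with p' h1 h2
    exact key _ _ _ hP h1 h2

theorem aux_deform {π L Y X : Type*} [Group π] [MulAction π L] [TopologicalSpace Y] [MulAction π Y]
    [ContinuousConstSMul π Y] [SimplyConnectedSpace Y]
    (D : AuxLab π L Y) [TopologicalSpace X] [TopologicalSpace.MetrizableSpace X]
    (q : Y → X) (hq : Continuous q)
    (hqinv : ∀ (g : π) y, q (g • y) = q y) (Q1 Q2 : Set X) (hQ1 : IsOpen Q1) (hQ2 : IsOpen Q2)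
    (l1 l2 : Y → L)
    (h1 : ∀ p, q p ∈ Q1 → p ∈ D.W (l1 p) ∧ (∀ h : π, l1 (h • p) = h • l1 p) ∧
      ∀ᶠ p' in 𝓝 p, l1 p' = l1 p)
    (h2 : ∀ p, q p ∈ Q2 → p ∈ D.W (l2 p) ∧ (∀ h : π, l2 (h • p) = h • l2 p) ∧
      ∀ᶠ p' in 𝓝 p, l2 p' = l2 p) :
    EquivDeformableTo (univ : Set π)
      {x : Y × Y | (q x.1 ∈ Q1 ∧ q x.2 ∈ Q1) ∨ (q x.1 ∈ Q2 ∧ q x.2 ∈ Q2)} (diagonal Y) := by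
  classical
  set U : Set (Y × Y) := {x : Y × Y | (q x.1 ∈ Q1 ∧ q x.2 ∈ Q1) ∨ (q x.1 ∈ Q2 ∧ q x.2 ∈ Q2)} with hU
  obtain ⟨sec, S, hsc, hsp, hss, hSc, hSp, hSs⟩ := aux_sec D
  -- the Urysohn function
  let V : Set (X × X) := (Q1 ×ˢ Q1) ∪ (Q2 ×ˢ Q2)
  have hF1 : IsClosed {x : V | x.1 ∉ Q2 ×ˢ Q2} :=
    isOpen_compl_iff.1 (by
      have : {x : V | x.1 ∉ Q2 ×ˢ Q2}ᶜ = Subtype.val ⁻¹' (Q2 ×ˢ Q2) := by ext x; simp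
      rw [this]; exact (hQ2.prod hQ2).preimage continuous_subtype_val)
  have hF2 : IsClosed {x : V | x.1 ∉ Q1 ×ˢ Q1} :=
    isOpen_compl_iff.1 (by
      have : {x : V | x.1 ∉ Q1 ×ˢ Q1}ᶜ = Subtype.val ⁻¹' (Q1 ×ˢ Q1) := by ext x; simp
      rw [this]; exact (hQ1.prod hQ1).preimage continuous_subtype_val)
  have hFd : Disjoint {x : V | x.1 ∉ Q2 ×ˢ Q2} {x : V | x.1 ∉ Q1 ×ˢ Q1} := by
    rw [Set.disjoint_left]
    intro x hx hx'
    exact x.2.elim hx' hx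
  have hnorm : NormalSpace V := by
    let _ := TopologicalSpace.metrizableSpaceMetric X
    infer_instance
  obtain ⟨f, hf0, hf1, -⟩ := exists_continuous_zero_one_of_isClosed hF1 hF2 hFd
  let fU : U → ℝ := fun u => f ⟨(q u.1.1, q u.1.2), u.2⟩
  have hfU : Continuous fU := by
    refine f.continuous.comp (Continuous.subtype_mk ?_ _)
    fun_prop
  let ρ : U → unitInterval := fun u => auxPr (3 * fU u - 1)
  have hρ : Continuous ρ := auxPr_cont.comp (by fun_prop)
  let φ : U → unitInterval → Y := fun u t =>
    if q u.1.1 ∈ Q2 ∧ q u.1.2 ∈ Q2 then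
      if q u.1.1 ∈ Q1 ∧ q u.1.2 ∈ Q1 then
        S (l1 u.1.1) (l2 u.1.1) (l1 u.1.2) (l2 u.1.2) (ρ u) u.1.1 u.1.2 t
      else sec (l2 u.1.1) (l2 u.1.2) u.1.1 u.1.2 t
    else sec (l1 u.1.1) (l1 u.1.2) u.1.1 u.1.2 t
  have hev : ∀ (Q : Set X) (hQ : IsOpen Q) (u0 : U), (q u0.1.1 ∈ Q ∧ q u0.1.2 ∈ Q) →
      ∀ t0 : unitInterval, ∀ᶠ x : U × unitInterval in 𝓝 (u0, t0), q x.1.1.1 ∈ Q ∧ q x.1.1.2 ∈ Q := by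
    intro Q hQ u0 hu0 t0
    have c1 : Continuous fun x : U × unitInterval => q x.1.1.1 := by fun_prop
    have c2 : Continuous fun x : U × unitInterval => q x.1.1.2 := by fun_prop
    exact (c1.continuousAt.eventually_mem (hQ.mem_nhds hu0.1)).and
      (c2.continuousAt.eventually_mem (hQ.mem_nhds hu0.2))
  have hlab : ∀ (l : Y → L) (u0 : U), (∀ᶠ p' in 𝓝 u0.1.1, l p' = l u0.1.1) →
      (∀ᶠ p' in 𝓝 u0.1.2, l p' = l u0.1.2) → ∀ t0 : unitInterval,
      ∀ᶠ x : U × unitInterval in 𝓝 (u0, t0), l x.1.1.1 = l u0.1.1 ∧ l x.1.1.2 = l u0.1.2 := by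
    intro l u0 ha hb t0
    have c1 : Continuous fun x : U × unitInterval => x.1.1.1 := by fun_prop
    have c2 : Continuous fun x : U × unitInterval => x.1.1.2 := by fun_prop
    exact ((c1.tendsto (u0, t0)).eventually ha).and ((c2.tendsto (u0, t0)).eventually hb)
  have hsecAt : ∀ a b (u0 : U) (t0 : unitInterval), u0.1.1 ∈ D.W a → u0.1.2 ∈ D.W b →
      ContinuousAt (fun x : U × unitInterval => sec a b x.1.1.1 x.1.1.2 x.2) (u0, t0) := by
    intro a b u0 t0 ha hb
    have := (hsc a b).continuousAt (x := ((u0.1.1, u0.1.2), t0))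
      ((((D.hWo a).prod (D.hWo b)).prod isOpen_univ).mem_nhds ⟨⟨ha, hb⟩, trivial⟩)
    exact ContinuousAt.comp (x := (u0, t0)) (f := fun x : U × unitInterval => ((x.1.1.1, x.1.1.2), x.2)) this
      (Continuous.continuousAt (by fun_prop))
  have hφ : Continuous fun x : U × unitInterval => φ x.1 x.2 := by
    rw [continuous_iff_continuousAt]
    rintro ⟨u0, t0⟩
    by_cases hB : q u0.1.1 ∈ Q2 ∧ q u0.1.2 ∈ Q2
    swap
    · have hA : q u0.1.1 ∈ Q1 ∧ q u0.1.2 ∈ Q1 := u0.2.resolve_right hB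
      have hf : fU u0 = 0 := hf0 (show (⟨(q u0.1.1, q u0.1.2), u0.2⟩ : V) ∈ {x : V | x.1 ∉ Q2 ×ˢ Q2} from hB)
      have hlt : ∀ᶠ x : U × unitInterval in 𝓝 (u0, t0), fU x.1 < 1 / 3 :=
        (hfU.comp continuous_fst).continuousAt.eventually_lt continuousAt_const
          (by show fU u0 < 1 / 3; rw [hf]; norm_num)
      refine (hsecAt (l1 u0.1.1) (l1 u0.1.2) u0 t0 (h1 _ hA.1).1 (h1 _ hA.2).1).congr ?_
      filter_upwards [hlt, hev Q1 hQ1 u0 hA t0, hlab l1 u0 (h1 _ hA.1).2.2 (h1 _ hA.2).2.2 t0]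
        with x hx hxA hxl
      rw [← hxl.1, ← hxl.2]
      simp only [φ]
      split_ifs with hxB
      · have : ρ x.1 = 0 := auxPr_zero _ (by linarith)
        rw [this]
        exact ((hSp _ _ _ _ _ _ ⟨(h1 _ hxA.1).1, (h2 _ hxB.1).1⟩ ⟨(h1 _ hxA.2).1, (h2 _ hxB.2).1⟩).1 _).symm
      · rfl
    by_cases hA : q u0.1.1 ∈ Q1 ∧ q u0.1.2 ∈ Q1
    swap
    · have hf : fU u0 = 1 := hf1 (show (⟨(q u0.1.1, q u0.1.2), u0.2⟩ : V) ∈ {x : V | x.1 ∉ Q1 ×ˢ Q1} from hA)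
      have hlt : ∀ᶠ x : U × unitInterval in 𝓝 (u0, t0), 2 / 3 < fU x.1 :=
        continuousAt_const.eventually_lt (hfU.comp continuous_fst).continuousAt
          (by show 2 / 3 < fU u0; rw [hf]; norm_num)
      refine (hsecAt (l2 u0.1.1) (l2 u0.1.2) u0 t0 (h2 _ hB.1).1 (h2 _ hB.2).1).congr ?_
      filter_upwards [hlt, hev Q2 hQ2 u0 hB t0, hlab l2 u0 (h2 _ hB.1).2.2 (h2 _ hB.2).2.2 t0]
        with x hx hxB hxl
      rw [← hxl.1, ← hxl.2]
      simp only [φ, if_pos hxB]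
      split_ifs with hxA
      · have : ρ x.1 = 1 := auxPr_one _ (by linarith)
        rw [this]
        exact ((hSp _ _ _ _ _ _ ⟨(h1 _ hxA.1).1, (h2 _ hxB.1).1⟩ ⟨(h1 _ hxA.2).1, (h2 _ hxB.2).1⟩).2.1 _).symm
      · rfl
    · have hc := (hSc (l1 u0.1.1) (l2 u0.1.1) (l1 u0.1.2) (l2 u0.1.2)).continuousAt
        (x := (((u0.1.1, u0.1.2), ρ u0), t0))
        ((((((D.hWo _).inter (D.hWo _)).prod ((D.hWo _).inter (D.hWo _))).prod isOpen_univ).prod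
          isOpen_univ).mem_nhds ⟨⟨⟨⟨(h1 _ hA.1).1, (h2 _ hB.1).1⟩, ⟨(h1 _ hA.2).1, (h2 _ hB.2).1⟩⟩,
            trivial⟩, trivial⟩)
      have hc' := ContinuousAt.comp (x := (u0, t0))
        (f := fun x : U × unitInterval => (((x.1.1.1, x.1.1.2), ρ x.1), x.2)) hc
        (Continuous.continuousAt (by fun_prop))
      refine hc'.congr ?_
      filter_upwards [hev Q1 hQ1 u0 hA t0, hlab l1 u0 (h1 _ hA.1).2.2 (h1 _ hA.2).2.2 t0,
        hev Q2 hQ2 u0 hB t0, hlab l2 u0 (h2 _ hB.1).2.2 (h2 _ hB.2).2.2 t0]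
        with x hxA hxl hxB hxl'
      simp only [φ, if_pos hxB, if_pos hxA, hxl.1, hxl.2, hxl'.1, hxl'.2, Function.comp]
  have hφ01 : ∀ u : U, φ u 0 = u.1.1 ∧ φ u 1 = u.1.2 := by
    intro u
    simp only [φ]
    split_ifs with hB hA
    · exact (hSp _ _ _ _ _ _ ⟨(h1 _ hA.1).1, (h2 _ hB.1).1⟩ ⟨(h1 _ hA.2).1, (h2 _ hB.2).1⟩).2.2 _
    · exact hsp _ _ _ _ (h2 _ hB.1).1 (h2 _ hB.2).1
    · have hA : q u.1.1 ∈ Q1 ∧ q u.1.2 ∈ Q1 := u.2.resolve_right hB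
      exact hsp _ _ _ _ (h1 _ hA.1).1 (h1 _ hA.2).1
  refine ⟨⟨fun x => (φ x.2 x.1, x.2.1.2), ?_⟩, ?_, ?_, ?_⟩
  · exact (hφ.comp (by fun_prop : Continuous fun x : unitInterval × U => (x.2, x.1))).prodMk (by fun_prop)
  · intro u
    exact Prod.ext (hφ01 u).1 rfl
  · intro u
    exact (hφ01 u).2
  · rintro t g - ⟨⟨p, r⟩, hu⟩ ⟨⟨p', r'⟩, hu'⟩ he
    obtain ⟨rfl, rfl⟩ : p' = g • p ∧ r' = g • r := by
      simpa [Prod.ext_iff] using he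
    refine Prod.ext ?_ rfl
    show φ _ t = g • φ _ t
    have hρe : ρ ⟨(g • p, g • r), hu'⟩ = ρ ⟨(p, r), hu⟩ := by
      simp only [ρ, fU, hqinv]
    simp only [φ, hρe, hqinv]
    split_ifs with hB hA
    · rw [(h1 _ hA.1).2.1, (h1 _ hA.2).2.1, (h2 _ hB.1).2.1, (h2 _ hB.2).2.1, hSs]
    · rw [(h2 _ hB.1).2.1, (h2 _ hB.2).2.1, hss]
    · have hA : q p ∈ Q1 ∧ q r ∈ Q1 := hu.resolve_right hB
      rw [(h1 _ hA.1).2.1, (h1 _ hA.2).2.1, hss]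
theorem auxGood_mono {Y : Type*} [TopologicalSpace Y] (M N : Set Y) (hM : AuxGood M) (h : N ⊆ M) :
    AuxGood N := by
  obtain ⟨μ, hc, hp⟩ := hM
  exact ⟨μ, hc.mono (prod_mono h (prod_mono h subset_rfl)), fun a ha b hb => hp a (h ha) b (h hb)⟩

/-- Labels: translates of base neighbourhoods. -/
def AuxL (π Y : Type*) := Y × π

instance auxLAct (π Y : Type*) [Group π] : MulAction π (AuxL π Y) where
  smul h a := (a.1, h * a.2)
  one_smul a := Prod.ext rfl (one_mul _)
  mul_smul g h a := Prod.ext rfl (mul_assoc _ _ _)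

theorem aux_lab {π Y : Type*} [Group π] [TopologicalSpace Y] [MulAction π Y] [ContinuousConstSMul π Y]
    (O W : Y → Set Y) (c : Y → Y → unitInterval → Y) (hWo : ∀ y, IsOpen (W y)) (hyW : ∀ y, y ∈ W y)
    (hd : ∀ y (g : π) w, w ∈ W y → g • w ∈ W y → g = 1) (hWO : ∀ y, W y ⊆ O y)
    (hc : ∀ y, ContinuousOn (fun x : Y × unitInterval => c y x.1 x.2) (W y ×ˢ univ))
    (hcp : ∀ y, ∀ p ∈ W y, c y p 0 = p ∧ c y p 1 = y ∧ ∀ t, c y p t ∈ O y)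
    (hstar : ∀ (g h : π) y y' w, g⁻¹ • w ∈ O y → h⁻¹ • w ∈ O y' →
        ∃ M, AuxGood M ∧ (∀ p, g⁻¹ • p ∈ O y → p ∈ M) ∧ (∀ p, h⁻¹ • p ∈ O y' → p ∈ M)) :
    Nonempty (AuxLab π (AuxL π Y) Y) := by
  have hinv : ∀ (h g : π) (p : Y), (h * g)⁻¹ • h • p = g⁻¹ • p := by
    intro h g p
    rw [mul_inv_rev, mul_smul, inv_smul_smul]
  refine ⟨{
    n := fun a => a.2
    W := fun a => {p | a.2⁻¹ • p ∈ W a.1}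
    c := fun a p t => a.2 • c a.1 (a.2⁻¹ • p) t
    cen := fun a => a.2 • a.1
    hn := fun h a => rfl
    hWo := fun a => (hWo a.1).preimage (continuous_const_smul _)
    hW := ?_
    hdisj := ?_
    hcov := fun p => ⟨(p, 1), by simpa using hyW p⟩
    hc := ?_
    hc0 := ?_
    hc1 := ?_
    hcs := ?_
    hcen := fun h a => mul_smul _ _ _
    star := ?_ }⟩
  · intro h a p hp
    show (h * a.2)⁻¹ • h • p ∈ W a.1
    rw [hinv]; exact hp
  · intro h a p hp hp'
    have hp' : (h * a.2)⁻¹ • p ∈ W a.1 := hp'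
    have := hd a.1 (a.2⁻¹ * h⁻¹ * a.2) _ hp (by
      rw [smul_smul, mul_inv_cancel_right, ← mul_inv_rev]; exact hp')
    have h3 : h⁻¹ = 1 := by
      have e : h⁻¹ = a.2 * (a.2⁻¹ * h⁻¹ * a.2) * a.2⁻¹ := by group
      rw [e, this]; simp
    exact inv_eq_one.1 h3
  · intro a
    refine ContinuousOn.const_smul (c := a.2) ?_
    exact (hc a.1).comp (f := fun x : Y × unitInterval => (a.2⁻¹ • x.1, x.2)) (by fun_prop)
      fun x hx => ⟨hx.1, trivial⟩
  · intro a p hp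
    show a.2 • c a.1 (a.2⁻¹ • p) 0 = p
    rw [(hcp a.1 _ hp).1, smul_inv_smul]
  · intro a p hp
    show a.2 • c a.1 (a.2⁻¹ • p) 1 = _
    rw [(hcp a.1 _ hp).2.1]
  · intro h a p t
    show (h * a.2) • c a.1 ((h * a.2)⁻¹ • h • p) t = h • a.2 • c a.1 (a.2⁻¹ • p) t
    rw [hinv, mul_smul]
  · intro a b p hp hp'
    obtain ⟨M, hM, h1, h2⟩ := hstar a.2 b.2 a.1 b.1 p (hWO _ hp) (hWO _ hp')
    refine ⟨M, hM, fun p hp t => h1 _ ?_, fun p hp t => h2 _ ?_⟩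
    · rw [inv_smul_smul]; exact (hcp _ _ hp).2.2 t
    · rw [inv_smul_smul]; exact (hcp _ _ hp).2.2 t

end AuxMain

/-- If a discrete group `π` acts freely and properly on a simply connected locally compact
metric ANR `Y` of covering dimension at most `k`, then `TC*_π(Y) ≤ k`: the space `Y × Y`
admits an open cover by `k + 1` sets, each invariant under the `(π × π)`-action and each
`π`-equivariantly (for the diagonal `π`-action) deformable to the diagonal `Δ(Y)`. -/
theorem TCstar_le_dim_of_free_proper_action
    {π : Type u} [Group π]
    {Y : Type u} [MetricSpace Y] [LocallyCompactSpace Y] [SimplyConnectedSpace Y]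
    [MulAction π Y]
    (hcont : ∀ g : π, Continuous fun y : Y => g • y)
    (hfree : ∀ (g : π) (y : Y), g • y = y → g = 1)
    (hproper : ∀ C : Set Y, IsCompact C → {g : π | ((g • C) ∩ C).Nonempty}.Finite)
    (hANR : IsANR Y)
    (k : ℕ) (hdim : CovDimLE Y k) :
    ∃ U : Fin (k + 1) → Set (Y × Y),
      (∀ i, IsOpen (U i)) ∧ (⋃ i, U i) = Set.univ ∧
      (∀ (i) (g h : π) (p : Y × Y), p ∈ U i → (g • p.1, h • p.2) ∈ U i) ∧
      ∀ i, EquivDeformableTo (Set.univ : Set π) (U i) (Set.diagonal Y) := by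
  classical
  have hcs : ContinuousConstSMul π Y := ⟨hcont⟩
  have hpc : PathConnectedSpace Y := inferInstance
  have hconn : ConnectedSpace Y := inferInstance
  obtain ⟨X, _, q, hY2, hpd, hT2, hX2, hXm, hq, hqo, hqs, hqe⟩ := aux_quot (π := π) hproper
  have hXpn : ParacompactSpace X ∧ NormalSpace X := by
    let _ := TopologicalSpace.metrizableSpaceMetric X
    exact ⟨inferInstance, inferInstance⟩
  obtain ⟨hXp, hXn⟩ := hXpn
  have hne : Nonempty X := ⟨q (Classical.arbitrary Y)⟩
  have hqinv : ∀ (g : π) y, q (g • y) = q y := fun g y => ((hqe _ _).2 ⟨g, rfl⟩).symm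
  -- good neighbourhoods with disjoint translates
  have hG : ∀ y : Y, ∃ G : Set Y, IsOpen G ∧ y ∈ G ∧ AuxGood G ∧
      ∀ (g : π) w, w ∈ G → g • w ∈ G → g = 1 := by
    intro y
    obtain ⟨M, hMo, hyM, hM⟩ := aux_good hANR y
    obtain ⟨N, hN, hNd⟩ := ProperlyDiscontinuousSMul.exists_nhds_image_smul_eq_self π y
    refine ⟨M ∩ interior N, hMo.inter isOpen_interior, ⟨hyM, mem_interior_iff_mem_nhds.2 hN⟩,
      auxGood_mono _ _ hM Set.inter_subset_left, ?_⟩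
    intro g w hw hgw
    exact hfree g y (hNd g ⟨g • w, ⟨w, interior_subset hw.2, rfl⟩, interior_subset hgw.2⟩)
  choose G hGo hyG hGg hGd using hG
  obtain ⟨O, hOo, hyO, hOG, hstar⟩ := aux_star q hq hqo hqs hqe G hGo hyG hGd hGg
  have hW := fun y => aux_contract y (G y) (hGo y) (hyG y) (hGg y) (O y) (hOo y) (hyO y)
  choose W c hWo hyW hWO hc hcp using hW
  obtain ⟨D⟩ := aux_lab (π := π) O W c hWo hyW
    (fun y g w h1 h2 => hGd y g w (hOG y (hWO y h1)) (hOG y (hWO y h2))) hWO hc hcp hstar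
  obtain ⟨V, hVo, hVc, hVs, hVord⟩ := aux_dim hdim q hq hqo hqs
    (fun y => ⟨G y, (hGo y).mem_nhds (hyG y), fun a ha b hb e => by
      obtain ⟨g, rfl⟩ := (hqe _ _).1 e
      rw [hGd y g a ha hb, one_smul]⟩)
    (fun a => q '' D.W a) (fun a => hqo _ (D.hWo a)) (by
      refine Set.eq_univ_of_forall fun x => ?_
      obtain ⟨y, rfl⟩ := hqs x
      obtain ⟨a, ha⟩ := D.hcov y
      exact Set.mem_iUnion.2 ⟨a, y, ha, rfl⟩)
  obtain ⟨𝒞, hCo, hCs, hCd, hCc⟩ := aux_kolm V hVo hVc k hVord k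
  have hlab := fun j => aux_colour D q hq hqe (𝒞 j) (hCo j)
    (fun P hP => (hCs j P hP).imp fun l hl => hl.trans (hVs l)) (hCd j)
  choose l hl using hlab
  have hQo : ∀ j, IsOpen (⋃₀ 𝒞 j) := fun j => isOpen_sUnion (hCo j)
  refine ⟨fun i => {x : Y × Y | (q x.1 ∈ ⋃₀ 𝒞 i ∧ q x.2 ∈ ⋃₀ 𝒞 i) ∨
    (q x.1 ∈ ⋃₀ 𝒞 (i + k) ∧ q x.2 ∈ ⋃₀ 𝒞 (i + k))}, ?_, ?_, ?_, ?_⟩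
  · intro i
    have key : ∀ j, IsOpen {x : Y × Y | q x.1 ∈ ⋃₀ 𝒞 j ∧ q x.2 ∈ ⋃₀ 𝒞 j} := fun j =>
      ((hQo j).preimage (hq.comp continuous_fst)).inter ((hQo j).preimage (hq.comp continuous_snd))
    exact (key _).union (key _)
  · refine Set.eq_univ_of_forall fun x => ?_
    obtain ⟨J, hJ, hJc, hJm⟩ := hCc (q x.1)
    obtain ⟨J', hJ', hJc', hJm'⟩ := hCc (q x.2)
    have hint : ∃ j, j ∈ J ∧ j ∈ J' := by
      by_contra hcon
      have hdis : Disjoint J J' := Finset.disjoint_left.2 fun j h h' => hcon ⟨j, h, h'⟩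
      have h1 := Finset.card_union_of_disjoint hdis
      have h2 := Finset.card_le_card (Finset.union_subset hJ hJ')
      rw [Finset.card_range] at h2
      omega
    obtain ⟨j, hj, hj'⟩ := hint
    have hjlt := Finset.mem_range.1 (hJ hj)
    rw [Set.mem_iUnion]
    by_cases hjk : j ≤ k
    · exact ⟨⟨j, by omega⟩, Or.inl ⟨hJm j hj, hJm' j hj'⟩⟩
    · refine ⟨⟨j - k, by omega⟩, Or.inr ?_⟩
      have e : j - k + k = j := by omega
      show q x.1 ∈ ⋃₀ 𝒞 (j - k + k) ∧ q x.2 ∈ ⋃₀ 𝒞 (j - k + k)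
      rw [e]
      exact ⟨hJm j hj, hJm' j hj'⟩
  · intro i g h p hp
    show (q (g • p.1) ∈ _ ∧ q (h • p.2) ∈ _) ∨ (q (g • p.1) ∈ _ ∧ q (h • p.2) ∈ _)
    rw [hqinv, hqinv]
    exact hp
  · intro i
    exact aux_deform D q hq hqinv (⋃₀ 𝒞 i) (⋃₀ 𝒞 (i + k)) (hQo _) (hQo _) (l i) (l (i + k))
      (hl i) (hl (i + k))
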